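/- arXiv:0811.2475 — 3 statements merged into one kernel-verified Lean document; each statement's English description precedes it below -/
import Mathlib

section
/- Let (X, R) be an imprimitive symmetric association scheme with n classes which is cometric with respect to the ordering E_0, E_1, …, E_n of its primitive idempotents, and set m = m_1. Then at least one of the following holds: (i) the scheme is Q-bipartite: a_i* = 0 for all 1 ≤ i ≤ n; (ii) the scheme is Q-antipodal: b_i* = c*_{n−i} for all 1 ≤ i ≤ n−1 with i ≠ ⌊n/2⌋; (iii) n = 4 and (b_0*, b_1*, b_2*; c_1*, c_2*, c_3*, c_4*) = (m, m−1, 1; 1, c_2*, m−b_3*, 1) with a_2* > 0; (iv) n = 6 and (b_0*, b_1*, b_2*, b_5*; c_1*, c_3*, c_4*, c_6*) = (m, m−1, 1, 1; 1, m−b_3*, 1, m) with a_2* = a_4* + a_5* > 0. -/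
open Matrix BigOperators
open scoped ComplexOrder
open scoped Fin.NatCast

namespace AssocScheme

variable (X : Type*) [Fintype X] [DecidableEq X]

/-- A commutative association scheme with `n` classes on a finite set `X`:
adjacency matrices `A 0, …, A n`, primitive idempotents `E 0, …, E n`,
and intersection numbers `p`. -/
structure Scheme (n : ℕ) where
  A : Fin (n + 1) → Matrix X X ℂ
  E : Fin (n + 1) → Matrix X X ℂ
  p : Fin (n + 1) → Fin (n + 1) → Fin (n + 1) → ℂ
  A_zeroOne : ∀ i x y, A i x y = 0 ∨ A i x y = 1
  A_zero : A 0 = 1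
  A_sum : ∑ i, A i = Matrix.of fun _ _ => (1 : ℂ)
  A_trans : ∀ i, ∃ i', (A i)ᵀ = A i'
  A_mul : ∀ i j, A i * A j = ∑ k, p i j k • A k
  A_comm : ∀ i j, A i * A j = A j * A i
  E_zero : E 0 = (Fintype.card X : ℂ)⁻¹ • Matrix.of fun _ _ => (1 : ℂ)
  E_ne : ∀ i, E i ≠ 0
  E_herm : ∀ i, (E i).IsHermitian
  E_mul : ∀ i j, E i * E j = if i = j then E i else 0
  E_sum : ∑ i, E i = 1
  E_span : ∀ i, E i ∈ Submodule.span ℂ (Set.range A)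

variable {X}
variable {n : ℕ}

/-- The scheme is symmetric: all adjacency matrices are symmetric. -/
def Scheme.IsSym (S : Scheme X n) : Prop := ∀ i, (S.A i)ᵀ = S.A i

/-- `P` is the first eigenmatrix. -/
def Scheme.IsP (S : Scheme X n) (P : Matrix (Fin (n + 1)) (Fin (n + 1)) ℂ) : Prop :=
  ∀ i, S.A i = ∑ j, P j i • S.E j

/-- `Q` is the second eigenmatrix. -/
def Scheme.IsQ (S : Scheme X n) (Q : Matrix (Fin (n + 1)) (Fin (n + 1)) ℂ) : Prop :=
  ∀ i, S.E i = (Fintype.card X : ℂ)⁻¹ • ∑ j, Q j i • S.A j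

/-- `q` is the family of Krein parameters of the scheme. -/
def Scheme.IsKrein (S : Scheme X n) (q : Fin (n + 1) → Fin (n + 1) → Fin (n + 1) → ℂ) : Prop :=
  ∀ i j, Matrix.hadamard (S.E i) (S.E j) = (Fintype.card X : ℂ)⁻¹ • ∑ k, q i j k • S.E k

/-- The scheme is metric (P-polynomial) w.r.t. the given ordering of the `A i`. -/
def Scheme.Metric (S : Scheme X n) : Prop :=
  ∀ i j k : Fin (n + 1), ((i : ℕ) + (j : ℕ) < (k : ℕ) → S.p i j k = 0) ∧
    ((k : ℕ) = (i : ℕ) + (j : ℕ) → S.p i j k ≠ 0)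

/-- The scheme is cometric (Q-polynomial) w.r.t. the given ordering of the `E i`,
with Krein parameters `q`. -/
def Scheme.Cometric (S : Scheme X n) (q : Fin (n + 1) → Fin (n + 1) → Fin (n + 1) → ℂ) : Prop :=
  S.IsKrein q ∧ ∀ i j k : Fin (n + 1), ((i : ℕ) + (j : ℕ) < (k : ℕ) → q i j k = 0) ∧
    ((k : ℕ) = (i : ℕ) + (j : ℕ) → q i j k ≠ 0)

/-- The scheme is imprimitive: some nontrivial relation is disconnected. -/
def Scheme.Imprimitive (S : Scheme X n) : Prop :=
  ∃ i : Fin (n + 1), i ≠ 0 ∧ ¬ ∀ x y : X, Relation.EqvGen (fun a b => S.A i a b = 1) x y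

/-- The inner distribution of a subset `Y`. -/
noncomputable def innerDist (S : Scheme X n) (Y : Finset X) : Fin (n + 1) → ℂ :=
  fun i => (Y.card : ℂ)⁻¹ * ∑ x ∈ Y, ∑ y ∈ Y, S.A i x y

/-- The MacWilliams transform `aQ` of a vector `a`. -/
noncomputable def macT (Q : Matrix (Fin (n + 1)) (Fin (n + 1)) ℂ) (a : Fin (n + 1) → ℂ) : Fin (n + 1) → ℂ :=
  fun i => ∑ j, a j * Q j i

/-- Entry `B_{x,i}` of the outer distribution of `Y`. -/
noncomputable def outerB (S : Scheme X n) (Y : Finset X) (x : X) (i : Fin (n + 1)) : ℂ :=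
  ∑ y ∈ Y, S.A i x y

/-- `Y` is completely regular: row `x` of the outer distribution depends only on
`min{j : B_{x,j} ≠ 0}`. -/
def CompletelyRegular (S : Scheme X n) (Y : Finset X) : Prop :=
  ∀ x x' : X,
    sInf {j : ℕ | outerB S Y x (j : Fin (n + 1)) ≠ 0} =
      sInf {j : ℕ | outerB S Y x' (j : Fin (n + 1)) ≠ 0} →
    ∀ i, outerB S Y x i = outerB S Y x' i

/-- `Y` is regular: `(A_i χ)_x = a_i` for all `x ∈ Y`. -/
def Regular (S : Scheme X n) (Y : Finset X) : Prop :=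
  ∀ x ∈ Y, ∀ i, outerB S Y x i = innerDist S Y i

/-- The restriction of the scheme to `Y` (on the `s+1` relations meeting `Y`)
is a symmetric association scheme with `s` classes which is cometric with respect
to some ordering of its primitive idempotents. -/
def CometricSubscheme (S : Scheme X n) (Y : Finset X) (s : ℕ) : Prop :=
  ∃ f : Fin (s + 1) → Fin (n + 1), Function.Injective f ∧
    (∀ j, f j = 0 ∨ innerDist S Y (f j) ≠ 0) ∧
    (∀ i : Fin (n + 1), (i = 0 ∨ innerDist S Y i ≠ 0) → ∃ j, f j = i) ∧
    ∃ (S' : Scheme {x // x ∈ Y} s) (q' : Fin (s + 1) → Fin (s + 1) → Fin (s + 1) → ℂ),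
      (∀ j (y y' : {x // x ∈ Y}), S'.A j y y' = S.A (f j) y.1 y'.1) ∧
      S'.IsSym ∧ S'.Cometric q'

end AssocScheme

namespace AssocScheme

set_option linter.unusedSectionVars false

/-- Real data extracted from a cometric scheme, indexed by natural numbers. -/
structure Core {X : Type*} [Fintype X] [DecidableEq X] (n : ℕ) (N : ℝ)
    (E : ℕ → Matrix X X ℝ) (q : ℕ → ℕ → ℕ → ℝ) : Prop where
  Npos : 0 < N
  sym : ∀ i, (E i)ᵀ = E i
  mul : ∀ i j, E i * E j = if i = j then E i else 0
  sum : ∑ i ∈ Finset.range (n + 1), E i = 1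
  zero : ∀ u v, E 0 u v = N⁻¹
  ne : ∀ i, i ≤ n → E i ≠ 0
  out : ∀ i, n < i → E i = 0
  qout : ∀ i j k, (n < i ∨ n < j ∨ n < k) → q i j k = 0
  krein : ∀ i j, Matrix.hadamard (E i) (E j) = N⁻¹ • ∑ k ∈ Finset.range (n + 1), q i j k • E k
  qzero : ∀ i j k, i + j < k → q i j k = 0
  qne : ∀ i j, i + j ≤ n → q i j (i + j) ≠ 0

namespace Core

variable {X : Type*} [Fintype X] [DecidableEq X] {n : ℕ} {N : ℝ}
  {E : ℕ → Matrix X X ℝ} {q : ℕ → ℕ → ℕ → ℝ}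

/-- Diagonal matrix of a column of `M`. -/
def Dg (M : Matrix X X ℝ) (a : X) : Matrix X X ℝ := Matrix.diagonal fun u => M u a

theorem Dg_T (M : Matrix X X ℝ) (a : X) : (Dg M a)ᵀ = Dg M a := by
  simp [Dg]

theorem Dg_comm (M M' : Matrix X X ℝ) (a b : X) : Dg M a * Dg M' b = Dg M' b * Dg M a := by
  simp [Dg, mul_comm]

theorem trace_sq_nonneg (M : Matrix X X ℝ) : 0 ≤ Matrix.trace (M * Mᵀ) := by
  simp only [Matrix.trace, Matrix.diag, Matrix.mul_apply, Matrix.transpose_apply]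
  exact Finset.sum_nonneg fun i _ => Finset.sum_nonneg fun j _ => mul_self_nonneg _

theorem trace_sq_zero (M : Matrix X X ℝ) (h : Matrix.trace (M * Mᵀ) = 0) : M = 0 := by
  simp only [Matrix.trace, Matrix.diag, Matrix.mul_apply, Matrix.transpose_apply] at h
  have h1 := (Finset.sum_eq_zero_iff_of_nonneg (f := fun i => ∑ j, M i j * M i j)
    (fun i _ => Finset.sum_nonneg fun j _ => mul_self_nonneg _)).1 h
  ext i j
  have h2 := (Finset.sum_eq_zero_iff_of_nonneg (f := fun j => M i j * M i j)
    (fun j _ => mul_self_nonneg _)).1 (h1 i (Finset.mem_univ _)) j (Finset.mem_univ _)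
  simpa using h2

theorem idem (H : Core n N E q) (i : ℕ) : E i * E i = E i := by simp [H.mul]

theorem idem' (H : Core n N E q) (i : ℕ) (M : Matrix X X ℝ) : E i * (E i * M) = E i * M := by
  rw [← mul_assoc, H.idem]

theorem symE (H : Core n N E q) (i : ℕ) (u v : X) : E i u v = E i v u := by
  conv_lhs => rw [← H.sym i]
  rfl

theorem sumD (H : Core n N E q) (i : ℕ) (M : Matrix X X ℝ) :
    ∑ a, Dg (E i) a * M * Dg (E i) a = Matrix.hadamard (E i) M := by
  ext u v
  simp only [Matrix.sum_apply, Dg, Matrix.mul_diagonal, Matrix.diagonal_mul, Matrix.hadamard_apply]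
  have h : ∑ a, E i u a * E i v a = E i u v := by
    conv_rhs => rw [← H.idem i]
    rw [Matrix.mul_apply]
    exact Finset.sum_congr rfl fun a _ => by rw [H.symE i v a]
  rw [← h, Finset.sum_mul]
  exact Finset.sum_congr rfl fun a _ => by ring

theorem sumD' (H : Core n N E q) (i : ℕ) (A M B : Matrix X X ℝ) :
    ∑ a, A * (Dg (E i) a * M * Dg (E i) a) * B = A * Matrix.hadamard (E i) M * B := by
  rw [← H.sumD, Finset.mul_sum, Finset.sum_mul]

theorem sumD2 (H : Core n N E q) (i : ℕ) (M : Matrix X X ℝ) :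
    ∑ a, ∑ b, E i a b • (Dg (E i) a * M * Dg (E i) b) = Matrix.hadamard (E i) M := by
  ext u v
  simp only [Matrix.sum_apply, Dg, Matrix.mul_diagonal, Matrix.diagonal_mul, Matrix.hadamard_apply,
    Matrix.smul_apply, smul_eq_mul]
  have h : ∑ a, ∑ b, E i u a * E i a b * E i b v = E i u v := by
    conv_rhs => rw [← H.idem i, ← H.idem' i]
    rw [Matrix.mul_apply]
    refine Finset.sum_congr rfl fun a _ => ?_
    rw [Matrix.mul_apply, Finset.mul_sum]
    exact Finset.sum_congr rfl fun b _ => by ring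
  rw [← h, Finset.sum_mul]
  refine Finset.sum_congr rfl fun a _ => ?_
  rw [Finset.sum_mul]
  exact Finset.sum_congr rfl fun b _ => by rw [H.symE i v b]; ring

theorem mul_had (H : Core n N E q) (i j k : ℕ) :
    E k * Matrix.hadamard (E i) (E j) = (N⁻¹ * q i j k) • E k := by
  rw [H.krein, Matrix.mul_smul, Finset.mul_sum, mul_smul]
  congr 1
  by_cases hk : k ≤ n
  · rw [Finset.sum_eq_single k]
    · rw [Matrix.mul_smul, H.idem]
    · intro b _ hb
      rw [Matrix.mul_smul, H.mul, if_neg (Ne.symm hb), smul_zero]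
    · intro h; simp at h; omega
  · rw [H.out k (by omega)]; simp

theorem had_mul (H : Core n N E q) (i j k : ℕ) :
    Matrix.hadamard (E i) (E j) * E k = (N⁻¹ * q i j k) • E k := by
  have := congrArg Matrix.transpose (H.mul_had i j k)
  rw [Matrix.transpose_mul, Matrix.transpose_smul, H.sym] at this
  rw [← this]
  congr 1
  ext u v
  simp [Matrix.hadamard_apply, H.symE i u v, H.symE j u v]

theorem m_pos (H : Core n N E q) (i : ℕ) (hi : i ≤ n) : 0 < Matrix.trace (E i) := by
  have h : Matrix.trace (E i) = Matrix.trace (E i * (E i)ᵀ) := by rw [H.sym, H.idem]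
  rw [h]
  refine lt_of_le_of_ne (trace_sq_nonneg _) fun h0 => H.ne i hi (trace_sq_zero _ h0.symm)

theorem tr3 (H : Core n N E q) (i j k : ℕ) :
    ∑ u, ∑ v, E i u v * E j u v * E k u v = N⁻¹ * q i j k * Matrix.trace (E k) := by
  have h := congrArg Matrix.trace (H.had_mul i j k)
  rw [Matrix.trace_smul, smul_eq_mul] at h
  rw [← h]
  simp only [Matrix.trace, Matrix.diag, Matrix.mul_apply, Matrix.hadamard_apply]
  exact Finset.sum_congr rfl fun u _ => Finset.sum_congr rfl fun v _ => by rw [H.symE k v u]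

theorem q_swap12 (H : Core n N E q) (i j k : ℕ) : q i j k = q j i k := by
  by_cases hk : k ≤ n
  · have h1 := H.tr3 i j k
    have h2 := H.tr3 j i k
    have h3 : N⁻¹ * q i j k * Matrix.trace (E k) = N⁻¹ * q j i k * Matrix.trace (E k) := by
      rw [← h1, ← h2]
      exact Finset.sum_congr rfl fun u _ => Finset.sum_congr rfl fun v _ => by ring
    have := H.m_pos k hk
    have := H.Npos
    field_simp at h3
    exact h3
  · rw [H.qout i j k (by omega), H.qout j i k (by omega)]

theorem q_swap23 (H : Core n N E q) (i j k : ℕ) :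
    q i j k * Matrix.trace (E k) = q i k j * Matrix.trace (E j) := by
  have h1 := H.tr3 i j k
  have h2 := H.tr3 i k j
  have h3 : N⁻¹ * q i j k * Matrix.trace (E k) = N⁻¹ * q i k j * Matrix.trace (E j) := by
    rw [← h1, ← h2]
    exact Finset.sum_congr rfl fun u _ => Finset.sum_congr rfl fun v _ => by ring
  have := H.Npos
  field_simp at h3
  exact h3

theorem q_zero23 (H : Core n N E q) {i j k : ℕ} (h : q i j k = 0) : q i k j = 0 := by
  by_cases hj : j ≤ n
  · have := H.q_swap23 i j k
    rw [h, zero_mul] at this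
    have h2 := H.m_pos j hj
    rcases mul_eq_zero.1 this.symm with h3 | h3
    · exact h3
    · exact absurd h3 h2.ne'
  · exact H.qout _ _ _ (by omega)

theorem q_zero13 (H : Core n N E q) {i j k : ℕ} (h : q i j k = 0) : q k j i = 0 := by
  rw [H.q_swap12]
  apply H.q_zero23
  rw [H.q_swap12]; exact h

/-- squares -/
theorem tr_sq (H : Core n N E q) (i j k : ℕ) :
    ∑ a, Matrix.trace ((E k * Dg (E i) a * E j) * (E k * Dg (E i) a * E j)ᵀ) =
      N⁻¹ * q i j k * Matrix.trace (E k) := by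
  have h : ∀ a, (E k * Dg (E i) a * E j) * (E k * Dg (E i) a * E j)ᵀ =
      E k * (Dg (E i) a * E j * Dg (E i) a) * E k := by
    intro a
    simp only [Matrix.transpose_mul, H.sym, Dg_T, mul_assoc, H.idem']
  simp only [h]
  rw [← Matrix.trace_sum, H.sumD', H.mul_had, Matrix.smul_mul, H.idem, Matrix.trace_smul, smul_eq_mul]

theorem q_nonneg (H : Core n N E q) (i j k : ℕ) : 0 ≤ q i j k := by
  by_cases hk : k ≤ n
  · have h := H.tr_sq i j k
    have h0 : 0 ≤ N⁻¹ * q i j k * Matrix.trace (E k) := by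
      rw [← h]; exact Finset.sum_nonneg fun a _ => trace_sq_nonneg _
    have h1 := H.m_pos k hk
    have h2 := inv_pos.2 H.Npos
    by_contra hc
    push Not at hc
    nlinarith [mul_pos h2 h1]
  · rw [H.qout i j k (by omega)]

theorem EDE_zero (H : Core n N E q) {i j k : ℕ} (h : q i j k = 0) (a : X) :
    E k * Dg (E i) a * E j = 0 := by
  have h1 := H.tr_sq i j k
  rw [h, mul_zero, zero_mul, Finset.sum_eq_zero_iff_of_nonneg (fun a _ => trace_sq_nonneg _)] at h1
  exact trace_sq_zero _ (h1 a (Finset.mem_univ _))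

theorem EDE_ne (H : Core n N E q) {i j k : ℕ} (h : q i j k ≠ 0) :
    ∃ a, E k * Dg (E i) a * E j ≠ 0 := by
  by_contra hc
  push Not at hc
  have h1 := H.tr_sq i j k
  simp only [hc, Matrix.zero_mul, Matrix.trace_zero, Finset.sum_const_zero] at h1
  have hk : k ≤ n := by
    by_contra hk
    exact h (H.qout i j k (by omega))
  have h2 := (H.m_pos k hk).ne'
  have h3 := (inv_pos.2 H.Npos).ne'
  exact mul_ne_zero (mul_ne_zero h3 h) h2 h1.symm

/-- tridiagonality -/
theorem q_far (H : Core n N E q) {j k : ℕ} (h : j + 1 < k ∨ k + 1 < j) : q 1 j k = 0 := by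
  rcases h with h | h
  · exact H.qzero _ _ _ (by omega)
  · exact H.q_zero23 (H.qzero _ _ _ (by omega))

theorem c_pos (H : Core n N E q) (j : ℕ) (h : j + 1 ≤ n) : 0 < q 1 j (j + 1) := by
  refine lt_of_le_of_ne (H.q_nonneg _ _ _) (Ne.symm ?_)
  have := H.qne 1 j (by omega)
  rwa [add_comm 1 j] at this

theorem b_pos (H : Core n N E q) (j : ℕ) (h : j + 1 ≤ n) : 0 < q 1 (j + 1) j := by
  refine lt_of_le_of_ne (H.q_nonneg _ _ _) (Ne.symm ?_)
  intro h0
  exact (H.c_pos j h).ne' (H.q_zero23 h0)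

theorem eq_of_E_mul (H : Core n N E q) {A B : Matrix X X ℝ} (h : ∀ l, E l * A = E l * B) : A = B := by
  have h1 : (∑ i ∈ Finset.range (n + 1), E i) * A = (∑ i ∈ Finset.range (n + 1), E i) * B := by
    rw [Finset.sum_mul, Finset.sum_mul]
    exact Finset.sum_congr rfl fun i _ => h i
  simpa [H.sum] using h1

theorem insert_id (H : Core n N E q) (A B : Matrix X X ℝ) :
    A * B = ∑ k ∈ Finset.range (n + 1), A * E k * B := by
  rw [← Finset.sum_mul, ← Finset.mul_sum, H.sum, mul_one]

theorem had_one_coef (H : Core n N E q) :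
    Matrix.hadamard (E 1) 1 = N⁻¹ • ∑ k ∈ Finset.range (n + 1),
      (∑ j ∈ Finset.range (n + 1), q 1 j k) • E k := by
  have : Matrix.hadamard (E 1) (1 : Matrix X X ℝ) =
      ∑ j ∈ Finset.range (n + 1), Matrix.hadamard (E 1) (E j) := by
    rw [← H.sum]
    ext u v
    simp [Matrix.hadamard_apply, Matrix.sum_apply, Finset.mul_sum]
  rw [this]
  simp only [H.krein]
  rw [← Finset.smul_sum, Finset.sum_comm]
  simp only [Finset.sum_smul]

theorem diag_const (H : Core n N E q) [Nonempty X] :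
    ∃ c : ℝ, Matrix.hadamard (E 1) 1 = c • (1 : Matrix X X ℝ) := by
  set r := (∑ j ∈ Finset.range (n + 1), q 1 j 0)
  have h : E 0 * Matrix.hadamard (E 1) 1 = (N⁻¹ * r) • E 0 := by
    rw [H.had_one_coef, Matrix.mul_smul, Finset.mul_sum, mul_smul]
    congr 1
    rw [Finset.sum_eq_single 0]
    · rw [Matrix.mul_smul, H.idem]
    · intro b _ hb
      rw [Matrix.mul_smul, H.mul, if_neg (Ne.symm hb), smul_zero]
    · intro h; simp at h
  refine ⟨N⁻¹ * r, ?_⟩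
  have hd : ∀ v, E 1 v v = N⁻¹ * r := by
    intro v
    have h1 := congrFun (congrFun h v) v
    rw [Matrix.mul_apply, Finset.sum_eq_single v] at h1
    · have h2 := (inv_pos.2 H.Npos).ne'
      simp only [Matrix.hadamard_apply, Matrix.one_apply_eq, mul_one, H.zero, Matrix.smul_apply,
        smul_eq_mul] at h1
      apply mul_left_cancel₀ h2
      rw [h1]; ring
    · intro b _ hb
      simp [Matrix.hadamard_apply, Matrix.one_apply_ne hb]
    · simp
  ext u v
  by_cases huv : u = v
  · subst huv; simp [hd]
  · simp [Matrix.one_apply_ne huv]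

theorem row_sum (H : Core n N E q) [Nonempty X] (hN : (Fintype.card X : ℝ) = N) (k : ℕ) (hk : k ≤ n) :
    ∑ j ∈ Finset.range (n + 1), q 1 j k = Matrix.trace (E 1) := by
  obtain ⟨c, hc⟩ := H.diag_const
  have hN0 := H.Npos
  have h1 : Matrix.trace (E 1) = c * N := by
    have := congrArg Matrix.trace hc
    rw [Matrix.trace_smul, Matrix.trace_one, hN, smul_eq_mul] at this
    rw [← this]
    simp [Matrix.trace]
  have h2 : E k * Matrix.hadamard (E 1) 1 =
      (N⁻¹ * ∑ j ∈ Finset.range (n + 1), q 1 j k) • E k := by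
    rw [H.had_one_coef, Matrix.mul_smul, Finset.mul_sum, mul_smul]
    congr 1
    rw [Finset.sum_eq_single k]
    · rw [Matrix.mul_smul, H.idem]
    · intro b _ hb
      rw [Matrix.mul_smul, H.mul, if_neg (Ne.symm hb), smul_zero]
    · intro h; simp at h; omega
  rw [hc, Matrix.mul_smul, mul_one] at h2
  have h3 := congrArg Matrix.trace h2
  rw [Matrix.trace_smul, Matrix.trace_smul, smul_eq_mul, smul_eq_mul] at h3
  have h4 := mul_right_cancel₀ (H.m_pos k hk).ne' h3
  rw [h1, h4]; field_simp

theorem q10 (H : Core n N E q) (hn : 1 ≤ n) : q 1 0 1 = 1 := by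
  have h : Matrix.hadamard (E 1) (E 0) = N⁻¹ • E 1 := by
    ext u v
    simp [Matrix.hadamard_apply, H.zero, mul_comm]
  have h1 := H.mul_had 1 0 1
  rw [h, Matrix.mul_smul, H.idem] at h1
  have h3 := congrArg Matrix.trace h1
  rw [Matrix.trace_smul, Matrix.trace_smul, smul_eq_mul, smul_eq_mul] at h3
  have h4 := mul_right_cancel₀ (H.m_pos 1 hn).ne' h3
  have := H.Npos
  field_simp at h4
  linarith

/-- Class row sums are constant on related indices. -/
theorem class_row (H : Core n N E q) (C I : Finset ℕ)
    (hC : ∀ k ∈ C, ∀ i ∈ I, ∀ l, q i k l ≠ 0 → l ∈ C) {i j l : ℕ} (hi : i ∈ I)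
    (hq : q i j l ≠ 0) : ∑ k ∈ C, q 1 k j = ∑ k ∈ C, q 1 k l := by
  set M := ∑ k ∈ C, E k with hM
  have hMT : Mᵀ = M := by simp [hM, Matrix.transpose_sum, H.sym]
  have hEM : ∀ l, E l * M = if l ∈ C then E l else 0 := by
    intro l
    simp [hM, Finset.mul_sum, H.mul]
  obtain ⟨a, ha⟩ := H.EDE_ne hq
  set D := Dg (E i) a with hD
  have hDT : Dᵀ = D := Dg_T _ _
  have h1 : D * M = M * D * M := by
    apply H.eq_of_E_mul
    intro l
    have e1 : E l * (M * D * M) = (E l * M) * (D * M) := by simp only [mul_assoc]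
    rw [e1, hEM]
    split_ifs with hl
    · rfl
    · rw [zero_mul, hM, ← mul_assoc, Finset.mul_sum]
      refine Finset.sum_eq_zero fun k hk => H.EDE_zero ?_ a
      by_contra hne
      exact hl (hC k hk i hi l hne)
  have h2 : M * D = M * D * M := by
    have := congrArg Matrix.transpose h1
    simpa [Matrix.transpose_mul, hMT, hDT, mul_assoc] using this
  have h3 : M * D = D * M := by rw [h1, ← h2]
  set G := Matrix.hadamard (E 1) M with hG
  have hcomm : G * D = D * G := by
    rw [hG, ← H.sumD, Finset.sum_mul, Finset.mul_sum]
    refine Finset.sum_congr rfl fun b _ => ?_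
    have hb := Dg_comm (E 1) (E i) b a
    rw [← hD] at hb
    calc Dg (E 1) b * M * Dg (E 1) b * D = Dg (E 1) b * M * (Dg (E 1) b * D) := by
          simp only [mul_assoc]
      _ = Dg (E 1) b * (M * D) * Dg (E 1) b := by rw [hb]; simp only [mul_assoc]
      _ = (Dg (E 1) b * D) * M * Dg (E 1) b := by rw [h3]; simp only [mul_assoc]
      _ = _ := by rw [hb]; simp only [mul_assoc]
  have hGsum : G = ∑ k ∈ C, Matrix.hadamard (E 1) (E k) := by
    rw [hG, hM]
    ext u v
    simp [Matrix.hadamard_apply, Matrix.sum_apply, Finset.mul_sum]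
  have hl : E l * G = (N⁻¹ * ∑ k ∈ C, q 1 k l) • E l := by
    rw [hGsum, Finset.mul_sum, Finset.mul_sum, Finset.sum_smul]
    exact Finset.sum_congr rfl fun k _ => H.mul_had _ _ _
  have hj : G * E j = (N⁻¹ * ∑ k ∈ C, q 1 k j) • E j := by
    rw [hGsum, Finset.sum_mul, Finset.mul_sum, Finset.sum_smul]
    exact Finset.sum_congr rfl fun k _ => H.had_mul _ _ _
  have e : E l * G * D * E j = E l * D * (G * E j) := by
    rw [mul_assoc (E l), hcomm]; simp only [mul_assoc]
  rw [hl, hj, Matrix.smul_mul, Matrix.smul_mul, Matrix.mul_smul] at e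
  have e2 := smul_left_injective ℝ ha e
  have h2 := (inv_pos.2 H.Npos).ne'
  exact (mul_left_cancel₀ h2 e2).symm

/-- Dimension bound. -/
theorem dim_bound (H : Core n N E q) (j : ℕ) :
    ∑ k ∈ Finset.range (n + 1), (if q 1 j k = 0 then 0 else Matrix.trace (E k)) ≤
      Matrix.trace (E 1) * Matrix.trace (E j) := by
  set G := Matrix.hadamard (E 1) (E j) with hG
  set Gp : Matrix X X ℝ := N • ∑ k ∈ Finset.range (n + 1), (q 1 j k)⁻¹ • E k with hGp
  set Pi : Matrix X X ℝ := ∑ k ∈ Finset.range (n + 1), (if q 1 j k = 0 then 0 else E k) with hPi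
  have hN := H.Npos
  have hGG : Gp * G = Pi := by
    rw [hGp, hPi, Matrix.smul_mul, Finset.sum_mul, Finset.smul_sum]
    refine Finset.sum_congr rfl fun k _ => ?_
    rw [Matrix.smul_mul, H.mul_had, smul_smul, smul_smul]
    split_ifs with h
    · simp [h]
    · have : N * (q 1 j k)⁻¹ * (N⁻¹ * q 1 j k) = 1 := by field_simp
      rw [this, one_smul]
  have hEPi : ∀ k ∈ Finset.range (n + 1), E k * Pi = if q 1 j k = 0 then 0 else E k := by
    intro k hk
    rw [hPi, Finset.mul_sum, Finset.sum_eq_single k]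
    · split_ifs <;> simp [H.idem]
    · intro b _ hb
      split_ifs
      · simp
      · rw [H.mul, if_neg (Ne.symm hb)]
    · intro h; exact absurd hk h
  have hPP : Pi * Pi = Pi := by
    conv_lhs => rw [hPi, Finset.sum_mul]
    rw [hPi]
    refine Finset.sum_congr rfl fun k hk => ?_
    have := hEPi k hk
    split_ifs with h
    · simp
    · rw [if_neg h] at this; exact this
  have htr : Matrix.trace Pi = ∑ k ∈ Finset.range (n + 1),
      (if q 1 j k = 0 then 0 else Matrix.trace (E k)) := by
    rw [hPi, Matrix.trace_sum]
    refine Finset.sum_congr rfl fun k hk => ?_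
    split_ifs <;> simp
  rw [← htr]
  have hGpT : Gpᵀ = Gp := by
    simp [hGp, Matrix.transpose_sum, H.sym]
  clear_value Gp Pi
  set D := Dg (E 1) with hD
  have hDT : ∀ a, (D a)ᵀ = D a := fun a => Dg_T _ _
  -- the blocks
  set S : X → X → Matrix X X ℝ := fun a b => E j * D a * Gp * D b * E j with hS
  have hST : ∀ a b, (S a b)ᵀ = S b a := by
    intro a b
    simp [hS, Matrix.transpose_mul, H.sym, hDT, hGpT, mul_assoc]
  have hpos : 0 ≤ ∑ a, ∑ b, Matrix.trace ((E 1 a b • E j - S a b) * (E 1 a b • E j - S a b)ᵀ) :=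
    Finset.sum_nonneg fun a _ => Finset.sum_nonneg fun b _ => trace_sq_nonneg _
  have hexp : ∀ a b, Matrix.trace ((E 1 a b • E j - S a b) * (E 1 a b • E j - S a b)ᵀ) =
      (E 1 a b * E 1 b a) * Matrix.trace (E j) -
      2 * Matrix.trace (E 1 a b • (E j * (D a * Gp * D b) * E j)) + Matrix.trace (S a b * S b a) := by
    intro a b
    have e1 : S a b * E j = S a b := by simp [hS, mul_assoc, H.idem]
    have e2 : E j * S b a = S b a := by simp [hS, mul_assoc, H.idem']
    have e4 : S a b = E j * (D a * Gp * D b) * E j := by simp [hS, mul_assoc]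
    have e3 : Matrix.trace (S b a) = Matrix.trace (S a b) := by
      rw [← hST, Matrix.trace_transpose]
    rw [← e4]
    simp only [Matrix.transpose_sub, Matrix.transpose_smul, H.sym, hST, Matrix.sub_mul,
      Matrix.mul_sub, Matrix.smul_mul, Matrix.mul_smul, e1, e2, H.idem, Matrix.trace_sub,
      Matrix.trace_smul, smul_eq_mul, e3, H.symE 1 b a]
    ring
  have t1 : ∑ a, ∑ b, (E 1 a b * E 1 b a) * Matrix.trace (E j) =
      Matrix.trace (E 1) * Matrix.trace (E j) := by
    simp only [← Finset.sum_mul]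
    congr 1
    conv_rhs => rw [← H.idem 1]
    simp [Matrix.trace, Matrix.mul_apply]
  have t2 : ∑ a, ∑ b, Matrix.trace (E 1 a b • (E j * (D a * Gp * D b) * E j)) = Matrix.trace Pi := by
    have : ∀ a b, E 1 a b • (E j * (D a * Gp * D b) * E j) =
        E j * (E 1 a b • (D a * Gp * D b)) * E j := by
      intro a b; rw [Matrix.mul_smul, Matrix.smul_mul]
    simp only [this, ← Matrix.trace_sum, ← Finset.mul_sum, ← Finset.sum_mul]
    rw [hD, H.sumD2, Matrix.trace_mul_comm, ← mul_assoc, H.idem, ← hGG, Matrix.trace_mul_comm Gp]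
    simp only [Matrix.trace, Matrix.diag, Matrix.mul_apply, hG, Matrix.hadamard_apply]
    refine Finset.sum_congr rfl fun u _ => Finset.sum_congr rfl fun v _ => ?_
    rw [H.symE 1 v u]; ring
  have t3 : ∑ a, ∑ b, Matrix.trace (S a b * S b a) = Matrix.trace Pi := by
    have e : ∀ a b, S a b * S b a = (E j * D a * Gp) * (D b * E j * D b) * (Gp * D a * E j) := by
      intro a b; simp [hS, mul_assoc, H.idem']
    simp only [e, ← Matrix.trace_sum, hD, H.sumD']
    rw [← hG, Matrix.trace_sum]
    have e2 : ∀ a, Matrix.trace (E j * Dg (E 1) a * Gp * G * (Gp * Dg (E 1) a * E j)) =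
        Matrix.trace ((Pi * Gp) * (Dg (E 1) a * E j * Dg (E 1) a) * 1) := by
      intro a
      have : E j * Dg (E 1) a * Gp * G * (Gp * Dg (E 1) a * E j) =
        (E j * Dg (E 1) a) * ((Pi * Gp) * Dg (E 1) a * E j) := by
        rw [← hGG]; simp only [mul_assoc]
      rw [this, Matrix.trace_mul_comm, mul_one]
      have : Pi * Gp * Dg (E 1) a * E j * (E j * Dg (E 1) a) =
          Pi * Gp * (Dg (E 1) a * E j * Dg (E 1) a) := by
        simp only [mul_assoc, H.idem']
      rw [this]
    simp only [e2, ← Matrix.trace_sum, H.sumD']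
    rw [← hG, mul_one, mul_assoc, hGG, hPP]
  simp only [hexp, Finset.sum_add_distrib, Finset.sum_sub_distrib, ← Finset.mul_sum, t1, t2, t3] at hpos
  linarith

end Core


namespace Core

variable {X : Type*} [Fintype X] [DecidableEq X] {n : ℕ} {N : ℝ}
  {E : ℕ → Matrix X X ℝ} {q : ℕ → ℕ → ℕ → ℝ}

theorem mid (H : Core n N E q) {e j t : ℕ} (he : e ≤ n)
    (h : ∀ k, k ≠ e → q 1 k j = 0 ∨ q 1 t k = 0) (a b : X) :
    E j * (Dg (E 1) a * (E e * (Dg (E 1) b * E t))) = E j * (Dg (E 1) a * (Dg (E 1) b * E t)) := by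
  have h1 := H.insert_id (E j * Dg (E 1) a) (Dg (E 1) b * E t)
  rw [Finset.sum_eq_single e] at h1
  · simp only [mul_assoc] at h1; exact h1.symm
  · intro k _ hk
    rcases h k hk with h0 | h0
    · rw [H.EDE_zero h0 a, zero_mul]
    · have := H.EDE_zero h0 b
      rw [mul_assoc] at this
      rw [mul_assoc, this, mul_zero]
  · intro h; simp at h; omega

theorem EDE_zero' (H : Core n N E q) {i j k : ℕ} (h : q i j k = 0) (a : X) (M : Matrix X X ℝ) :
    E k * (Dg (E i) a * (E j * M)) = 0 := by
  have := H.EDE_zero h a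
  calc E k * (Dg (E i) a * (E j * M)) = E k * Dg (E i) a * E j * M := by simp only [mul_assoc]
    _ = 0 := by rw [this, zero_mul]

theorem EDE_zero'' (H : Core n N E q) {i j k : ℕ} (h : q i j k = 0) (a : X) :
    E k * (Dg (E i) a * E j) = 0 := by
  have := H.EDE_zero h a
  rwa [mul_assoc] at this

theorem mid' (H : Core n N E q) {e j t : ℕ} (he : e ≤ n)
    (h : ∀ k, k ≠ e → q 1 k j = 0 ∨ q 1 t k = 0) (a b : X) (M : Matrix X X ℝ) :
    E j * (Dg (E 1) a * (E e * (Dg (E 1) b * (E t * M)))) =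
      E j * (Dg (E 1) a * (Dg (E 1) b * (E t * M))) := by
  have := congrArg (· * M) (H.mid he h a b)
  simpa only [mul_assoc] using this

theorem Dg_comm' (M M' : Matrix X X ℝ) (a b : X) (B : Matrix X X ℝ) :
    Dg M a * (Dg M' b * B) = Dg M' b * (Dg M a * B) := by
  rw [← mul_assoc, Dg_comm, mul_assoc]

/-- If `a_i* = 0` for some `1 ≤ i < n` then `a_1* = 0`. -/
theorem a1_zero (H : Core n N E q) (s : ℕ) (hs : s + 2 ≤ n) (h0 : q 1 (s + 1) (s + 1) = 0) :
    q 1 1 1 = 0 := by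
  set D := Dg (E 1) with hD
  set g := Matrix.hadamard (E 1) (E s) with hg
  have hDT : ∀ a, (D a)ᵀ = D a := fun a => Dg_T _ _
  have F1 : ∀ a b, E (s+2) * (D a * (E (s+1) * (D b * E s))) = E (s+2) * (D a * (D b * E s)) := by
    refine H.mid (by omega) fun k hk => ?_
    rcases lt_or_gt_of_ne hk with h | h
    · left; exact H.q_far (by omega)
    · right; exact H.q_far (by omega)
  -- decomposition of W
  have hW : ∀ a b c, E (s+2) * (D a * (D c * (D b * E s))) =
      E (s+2) * (D a * (E (s+1) * (D c * (D b * E s)))) +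
      E (s+2) * (D a * (D c * (E (s+1) * (D b * E s)))) := by
    intro a b c
    have h1 := H.insert_id (E (s+2) * D a) (D c * (D b * E s))
    have hsub : ({s+1, s+2} : Finset ℕ) ⊆ Finset.range (n + 1) := by
      intro k hk; simp at hk ⊢; omega
    rw [← Finset.sum_subset hsub, Finset.sum_pair (by omega)] at h1
    · simp only [mul_assoc] at h1
      rw [h1, ← F1 c b]
      congr 1
      have := H.mid' (e := s+2) (j := s+2) (t := s+1) hs (fun k hk => ?_) a c (D b * E s)
      · rw [this]
      · by_cases hk1 : k = s + 1
        · right; rw [hk1]; exact h0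
        · rcases lt_or_gt_of_ne hk with h | h
          · left; exact H.q_far (by omega)
          · right; exact H.q_far (by omega)
    · intro k _ hk
      simp only [Finset.mem_insert, Finset.mem_singleton, not_or] at hk
      by_cases hk1 : k < s + 1
      · have := H.EDE_zero (i := 1) (j := k) (k := s+2) (H.q_far (by omega)) a
        rw [this, zero_mul]
      · have h2 : E k * (D c * (D b * E s)) = 0 := by
          have := H.insert_id (E k * D c) (D b * E s)
          rw [mul_assoc] at this
          rw [this]
          refine Finset.sum_eq_zero fun l _ => ?_
          by_cases hl : l ≤ s + 1
          · have := H.EDE_zero (i := 1) (j := l) (k := k) (H.q_far (by omega)) c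
            rw [this, zero_mul]
          · have := H.EDE_zero'' (i := 1) (j := s) (k := l) (H.q_far (by omega)) b
            rw [mul_assoc, this, mul_zero]
        rw [mul_assoc, h2, mul_zero]
  have z1 : ∀ a, E (s+1) * (D a * E (s+1)) = 0 := fun a => H.EDE_zero'' h0 a
  -- inner products
  have hT : ∀ w a b, ∑ c, Matrix.trace (E (s+2) * (D w * (D c * E s)) *
      (E (s+2) * (D a * (D c * (D b * E s))))ᵀ) = 0 := by
    intro w a b
    simp only [hW a b, Matrix.transpose_add, Matrix.mul_add, Matrix.trace_add,
      Finset.sum_add_distrib]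
    have p1 : ∑ c, Matrix.trace (E (s+2) * (D w * (D c * E s)) *
      (E (s+2) * (D a * (E (s+1) * (D c * (D b * E s)))))ᵀ) = 0 := by
      have : ∀ c, E (s+2) * (D w * (D c * E s)) *
          (E (s+2) * (D a * (E (s+1) * (D c * (D b * E s)))))ᵀ =
          (E (s+2) * D w * E (s+1)) * (D c * E s * D c) * (D b * (E (s+1) * (D a * E (s+2)))) := by
        intro c
        rw [← F1 w c]
        simp only [Matrix.transpose_mul, H.sym, hDT, mul_assoc, H.idem']
        rw [hD, Dg_comm' (E 1) (E 1) b c]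
      simp only [this, ← Matrix.trace_sum]
      rw [hD, H.sumD', mul_assoc (E (s+2) * Dg (E 1) w), H.mul_had]
      have : E (s+2) * Dg (E 1) w * ((N⁻¹ * q 1 s (s+1)) • E (s+1)) *
          (Dg (E 1) b * (E (s+1) * (Dg (E 1) a * E (s+2)))) = 0 := by
        rw [Matrix.mul_smul, Matrix.smul_mul]
        have e : E (s+2) * Dg (E 1) w * E (s+1) * (Dg (E 1) b * (E (s+1) * (Dg (E 1) a * E (s+2))))
          = E (s+2) * Dg (E 1) w * (E (s+1) * (Dg (E 1) b * E (s+1)) * (Dg (E 1) a * E (s+2))) := by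
          simp only [mul_assoc]
        rw [e, ← hD, z1, zero_mul, mul_zero, smul_zero]
      rw [this, Matrix.trace_zero]
    have p2 : ∑ c, Matrix.trace (E (s+2) * (D w * (D c * E s)) *
      (E (s+2) * (D a * (D c * (E (s+1) * (D b * E s)))))ᵀ) = 0 := by
      have : ∀ c, Matrix.trace (E (s+2) * (D w * (D c * E s)) *
          (E (s+2) * (D a * (D c * (E (s+1) * (D b * E s)))))ᵀ) =
          Matrix.trace ((E (s+1) * (D w * (E s * (D b * (E (s+1) * D a))))) *
            (D c * E (s+2) * D c) * E (s+1)) := by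
        intro c
        have e0 : E (s+2) * (D w * (D c * E s)) = E (s+2) * (D c * (E (s+1) * (D w * E s))) := by
          rw [F1 c w, hD, Dg_comm' (E 1) (E 1) w c]
        rw [e0, Matrix.trace_mul_comm ((E (s+1) * (D w * (E s * (D b * (E (s+1) * D a))))) *
            (D c * E (s+2) * D c))]
        have e1 : E (s+2) * (D c * (E (s+1) * (D w * E s))) *
            (E (s+2) * (D a * (D c * (E (s+1) * (D b * E s)))))ᵀ =
            (E (s+2) * D c) * ((E (s+1) * (D w * (E s * (D b * (E (s+1) * (D a * (D c * E (s+2))))))))) := by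
          simp only [Matrix.transpose_mul, H.sym, hDT, mul_assoc, H.idem']
          rw [hD, Dg_comm' (E 1) (E 1) c a]
        rw [e1, Matrix.trace_mul_comm]
        congr 1
        simp only [mul_assoc, H.idem']
      simp only [this, ← Matrix.trace_sum]
      rw [hD, H.sumD', mul_assoc, H.had_mul]
      have e : E (s+1) * (Dg (E 1) w * (E s * (Dg (E 1) b * (E (s+1) * Dg (E 1) a)))) *
          ((N⁻¹ * q 1 (s+2) (s+1)) • E (s+1)) = 0 := by
        rw [Matrix.mul_smul]
        have e : E (s+1) * (Dg (E 1) w * (E s * (Dg (E 1) b * (E (s+1) * Dg (E 1) a)))) * E (s+1)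
          = E (s+1) * (Dg (E 1) w * (E s * (Dg (E 1) b * (E (s+1) * (Dg (E 1) a * E (s+1)))))) := by
          simp only [mul_assoc]
        rw [e, ← hD, z1]; simp
      rw [e, Matrix.trace_zero]
    rw [p1, p2, add_zero]
  have hT2 : ∀ w a b, ∑ u, ∑ v, E (s+2) u v * E 1 v w * g v u * (E 1 u a * E 1 u b) = 0 := by
    intro w a b
    have h := hT w a b
    have : ∀ c, Matrix.trace (E (s+2) * (D w * (D c * E s)) *
      (E (s+2) * (D a * (D c * (D b * E s))))ᵀ) =
      Matrix.trace ((E (s+2) * D w) * (D c * E s * D c) * (D b * D a)) := by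
      intro c
      have e1 : E (s+2) * (D w * (D c * E s)) * (E (s+2) * (D a * (D c * (D b * E s))))ᵀ =
        (E (s+2) * (D w * (D c * (E s * (D c * (D b * D a)))))) * E (s+2) := by
        simp only [Matrix.transpose_mul, H.sym, hDT, mul_assoc, H.idem']
        rw [hD, Dg_comm' (E 1) (E 1) b c]
      rw [e1, Matrix.trace_mul_comm]
      simp only [mul_assoc, H.idem']
    simp only [this, ← Matrix.trace_sum] at h
    rw [hD, H.sumD', ← hg] at h
    rw [← h]
    simp only [Matrix.trace, Matrix.diag, Dg, Matrix.diagonal_mul_diagonal, Matrix.mul_diagonal]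
    refine Finset.sum_congr rfl fun u _ => ?_
    rw [Matrix.mul_apply, Finset.sum_mul]
    refine Finset.sum_congr rfl fun v _ => ?_
    rw [Matrix.mul_diagonal]; ring
  have hE1 : ∀ u w, ∑ a, E 1 w a * E 1 u a = E 1 u w := by
    intro u w
    conv_rhs => rw [← H.idem 1]
    rw [Matrix.mul_apply]
    exact Finset.sum_congr rfl fun a _ => by rw [H.symE 1 w a]; ring
  have hfin : ∑ w, ∑ u, ∑ v, E (s+2) u v * E 1 v w * g v u * (E 1 u w * E 1 u w) = 0 := by
    refine Finset.sum_eq_zero fun w _ => ?_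
    have h1 : ∑ a, ∑ b, (E 1 w a * E 1 w b) *
      (∑ u, ∑ v, E (s+2) u v * E 1 v w * g v u * (E 1 u a * E 1 u b)) = 0 := by
      simp [hT2]
    rw [← h1]
    simp only [Finset.mul_sum]
    have : ∀ u v, E (s+2) u v * E 1 v w * g v u * (E 1 u w * E 1 u w) =
      ∑ a, ∑ b, E 1 w a * E 1 w b * (E (s+2) u v * E 1 v w * g v u * (E 1 u a * E 1 u b)) := by
      intro u v
      rw [← hE1 u w, Finset.sum_mul_sum, Finset.mul_sum]
      refine Finset.sum_congr rfl fun a _ => ?_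
      rw [Finset.mul_sum]
      exact Finset.sum_congr rfl fun b _ => by ring
    simp only [this]
    rw [Finset.sum_congr rfl fun u _ => Finset.sum_comm]
    rw [Finset.sum_comm]
    refine Finset.sum_congr rfl fun a _ => ?_
    rw [Finset.sum_congr rfl fun u _ => Finset.sum_comm]
    rw [Finset.sum_comm]
  have h11 : ∀ u v, ∑ w, (E 1 u w * E 1 u w) * E 1 v w = N⁻¹ * q 1 1 1 * E 1 u v := by
    intro u v
    have := congrFun (congrFun (H.had_mul 1 1 1) u) v
    rw [Matrix.mul_apply] at this
    simp only [Matrix.hadamard_apply, Matrix.smul_apply, smul_eq_mul] at this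
    rw [← this]
    exact Finset.sum_congr rfl fun w _ => by rw [H.symE 1 v w]
  set G := Matrix.hadamard (E 1) (E (s+2)) with hG
  have hfin2 : N⁻¹ * q 1 1 1 * Matrix.trace (G * g) = 0 := by
    rw [← hfin, Finset.sum_comm]
    simp only [Matrix.trace, Matrix.diag, Matrix.mul_apply, Finset.mul_sum]
    refine Finset.sum_congr rfl fun u _ => ?_
    rw [Finset.sum_comm]
    refine Finset.sum_congr rfl fun v _ => ?_
    have : ∀ w, E (s+2) u v * E 1 v w * g v u * (E 1 u w * E 1 u w) =
      (E (s+2) u v * g v u) * ((E 1 u w * E 1 u w) * E 1 v w) := fun w => by ring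
    simp only [this, ← Finset.mul_sum, h11, hG, Matrix.hadamard_apply]
    ring
  have htr : 0 < Matrix.trace (G * g) := by
    have e : G * g = N⁻¹ • ∑ k ∈ Finset.range (n+1), (q 1 (s+2) k * (N⁻¹ * q 1 s k)) • E k := by
      rw [hG, H.krein, Matrix.smul_mul, Finset.sum_mul]
      congr 1
      refine Finset.sum_congr rfl fun k _ => ?_
      rw [Matrix.smul_mul, hg, H.mul_had, smul_smul]
    rw [e, Matrix.trace_smul, Matrix.trace_sum, smul_eq_mul]
    have hN := H.Npos
    refine mul_pos (inv_pos.2 hN) ?_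
    refine Finset.sum_pos' (fun k hk => ?_) ⟨s+1, by simp; omega, ?_⟩
    · rw [Matrix.trace_smul, smul_eq_mul]
      have := H.q_nonneg 1 (s+2) k
      have := H.q_nonneg 1 s k
      have := (H.m_pos k (by simp at hk; omega)).le
      positivity
    · rw [Matrix.trace_smul, smul_eq_mul]
      have := H.b_pos (s+1) (by omega)
      have := H.c_pos s (by omega)
      have := H.m_pos (s+1) (by omega)
      positivity
  have hN := (inv_pos.2 H.Npos).ne'
  rcases mul_eq_zero.1 hfin2 with h | h
  · rcases mul_eq_zero.1 h with h | h
    · exact absurd h hN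
    · exact h
  · exact absurd h htr.ne'

/-- Cauchy–Schwarz bound. -/
theorem cs_bound (H : Core n N E q) [Nonempty X] (hN : (Fintype.card X : ℝ) = N) (hn1 : 1 ≤ n)
    (t e : ℕ) (ht : t ≤ n) (he : e ≤ n) (hte : e + 1 = t ∨ e = t + 1) (h0 : q 1 t t = 0) :
    2 * q 1 e t ≤ Matrix.trace (E 1) * (q 1 e t - Matrix.trace (E 1) + 2 * q 1 t e) := by
  set D := Dg (E 1) with hD
  have hDT : ∀ a, (D a)ᵀ = D a := fun a => Dg_T _ _
  set m := Matrix.trace (E 1) with hm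
  set mt := Matrix.trace (E t) with hmt
  set κ := q 1 t e with hκ
  set κ' := q 1 e t with hκ'
  have hmpos : 0 < m := H.m_pos 1 hn1
  have hmtpos : 0 < mt := H.m_pos t ht
  have hκpos : 0 < κ' := by
    rcases hte with h | h
    · rw [hκ', ← h]; exact H.c_pos e (by omega)
    · rw [hκ', h]; exact H.b_pos t (by omega)
  have hNpos := H.Npos
  have hswap : ∀ j, j ≠ t → ∀ a b, E j * (D a * (E e * (D b * E t))) =
      E j * (D b * (E e * (D a * E t))) := by
    intro j hj a b
    by_cases hf : q 1 e j = 0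
    · rw [H.EDE_zero' hf, H.EDE_zero' hf]
    · have hje : ¬ (e + 1 < j ∨ j + 1 < e) := fun h => hf (H.q_far h)
      have hc : ∀ k, k ≠ e → q 1 k j = 0 ∨ q 1 t k = 0 := by
        intro k hk
        by_cases hkt : k = t
        · right; rw [hkt]; exact h0
        · by_cases hkf : t + 1 < k ∨ k + 1 < t
          · right; exact H.q_far hkf
          · left; exact H.q_far (by omega)
      rw [H.mid he hc, H.mid he hc, Dg_comm' (E 1) (E 1) b a]
  set P : X → X → Matrix X X ℝ := fun a b => E t * (D a * (E e * (D b * E t))) with hP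
  have hPT : ∀ a b, (P a b)ᵀ = P b a := by
    intro a b
    simp only [hP, Matrix.transpose_mul, H.sym, hDT, mul_assoc]
  have hY : ∀ j, ∑ a, ∑ b, Matrix.trace (E t * (D a * (E e * (D b * (E j * (D b * (E e * (D a * E t)))))))) =
      N⁻¹ * N⁻¹ * q 1 j e * κ' * mt := by
    intro j
    have e1 : ∀ a, ∑ b, Matrix.trace (E t * (D a * (E e * (D b * (E j * (D b * (E e * (D a * E t)))))))) =
        (N⁻¹ * q 1 j e) * Matrix.trace (E t * (D a * E e * D a) * E t) := by
      intro a
      have : ∀ b, E t * (D a * (E e * (D b * (E j * (D b * (E e * (D a * E t))))))) =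
        (E t * D a * E e) * (D b * E j * D b) * (E e * (D a * E t)) := fun b => by
        simp only [mul_assoc]
      simp only [this, ← Matrix.trace_sum]
      rw [hD, H.sumD', mul_assoc (E t * _), H.mul_had, Matrix.mul_smul, Matrix.smul_mul,
        Matrix.trace_smul, smul_eq_mul]
      congr 2
      simp only [mul_assoc, H.idem']
    simp only [e1, ← Finset.mul_sum, ← Matrix.trace_sum]
    rw [hD, H.sumD', H.mul_had, Matrix.smul_mul, H.idem, Matrix.trace_smul, smul_eq_mul]
    ring
  have hS1 : ∑ a, ∑ b, Matrix.trace (P a b * P b a) = N⁻¹ * N⁻¹ * κ * κ' * mt := by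
    rw [← hY t]
    refine Finset.sum_congr rfl fun a _ => Finset.sum_congr rfl fun b _ => ?_
    simp only [hP, mul_assoc, H.idem']
  have hXj : ∀ j, j ≠ t → ∑ a, ∑ b, Matrix.trace (E t * (D a * (E e * (D b * (E j * (D a * (E e * (D b * E t)))))))) =
      N⁻¹ * N⁻¹ * q 1 j e * κ' * mt := by
    intro j hj
    rw [← hY j]
    refine Finset.sum_congr rfl fun a _ => Finset.sum_congr rfl fun b _ => ?_
    rw [hswap j hj a b]
  have hXall : ∑ j ∈ Finset.range (n+1), ∑ a, ∑ b,
      Matrix.trace (E t * (D a * (E e * (D b * (E j * (D a * (E e * (D b * E t)))))))) =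
      N⁻¹ * N⁻¹ * κ' * κ' * mt := by
    have e0 : ∀ a b, ∑ j ∈ Finset.range (n+1),
        Matrix.trace (E t * (D a * (E e * (D b * (E j * (D a * (E e * (D b * E t)))))))) =
        Matrix.trace ((E t * (D a * (E e * D a))) * (D b * E e * D b) * E t) := by
      intro a b
      have : (E t * (D a * (E e * D a))) * (D b * E e * D b) * E t =
          (E t * (D a * (E e * D b))) * (D a * (E e * (D b * E t))) := by
        simp only [mul_assoc]
        rw [hD, Dg_comm' (E 1) (E 1) a b]
      rw [this, H.insert_id (E t * (D a * (E e * D b))) (D a * (E e * (D b * E t))), Matrix.trace_sum]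
      refine Finset.sum_congr rfl fun j _ => ?_
      simp only [mul_assoc]
    rw [Finset.sum_comm]
    have e1 : ∀ a, ∑ j ∈ Finset.range (n+1), ∑ b,
      Matrix.trace (E t * (D a * (E e * (D b * (E j * (D a * (E e * (D b * E t)))))))) =
      (N⁻¹ * κ') * Matrix.trace (E t * (D a * E e * D a) * E t) := by
      intro a
      rw [Finset.sum_comm]
      simp only [e0, ← Matrix.trace_sum]
      rw [hD, H.sumD', mul_assoc, H.had_mul, Matrix.mul_smul, Matrix.trace_smul, smul_eq_mul]
      congr 2
      simp only [mul_assoc]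
    rw [Finset.sum_congr rfl fun a _ => e1 a]
    simp only [← Finset.mul_sum, ← Matrix.trace_sum]
    rw [hD, H.sumD', H.mul_had, Matrix.smul_mul, H.idem, Matrix.trace_smul, smul_eq_mul]
    ring
  have hx : ∑ a, ∑ b, Matrix.trace (P a b * P a b) = N⁻¹ * N⁻¹ * κ' * mt * (κ' - m + κ) := by
    have htm : t ∈ Finset.range (n+1) := by simp; omega
    have h1 := hXall
    rw [← Finset.add_sum_erase _ _ htm] at h1
    have h2 : ∑ j ∈ (Finset.range (n+1)).erase t, ∑ a, ∑ b,
        Matrix.trace (E t * (D a * (E e * (D b * (E j * (D a * (E e * (D b * E t)))))))) =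
        N⁻¹ * N⁻¹ * (m - κ) * κ' * mt := by
      have h3 := H.row_sum hN e he
      rw [← Finset.add_sum_erase _ _ htm] at h3
      rw [Finset.sum_congr rfl fun j hj => hXj j (Finset.ne_of_mem_erase hj)]
      rw [← Finset.sum_mul, ← Finset.sum_mul, ← Finset.mul_sum]
      have : ∑ j ∈ (Finset.range (n+1)).erase t, q 1 j e = m - κ := by linarith
      rw [this]
    rw [h2] at h1
    have h4 : ∑ a, ∑ b, Matrix.trace (P a b * P a b) = ∑ a, ∑ b,
        Matrix.trace (E t * (D a * (E e * (D b * (E t * (D a * (E e * (D b * E t)))))))) := by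
      refine Finset.sum_congr rfl fun a _ => Finset.sum_congr rfl fun b _ => ?_
      simp only [hP, mul_assoc, H.idem']
    rw [h4]
    linear_combination h1
  have hS2 : ∑ a, ∑ b, E 1 a b * Matrix.trace (P a b) = N⁻¹ * κ' * mt := by
    have e1 : ∀ a b, E 1 a b * Matrix.trace (P a b) =
        Matrix.trace (E t * (E 1 a b • (D a * E e * D b)) * E t) := by
      intro a b
      rw [Matrix.mul_smul, Matrix.smul_mul, Matrix.trace_smul, smul_eq_mul]
      simp only [hP, mul_assoc]
    simp only [e1, ← Matrix.trace_sum, ← Finset.mul_sum, ← Finset.sum_mul]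
    rw [hD, H.sumD2, H.mul_had, Matrix.smul_mul, H.idem, Matrix.trace_smul, smul_eq_mul]
  have hE : ∑ a, ∑ b, E 1 a b * E 1 a b = m := by
    rw [hm]
    conv_rhs => rw [← H.idem 1]
    simp only [Matrix.trace, Matrix.diag, Matrix.mul_apply]
    exact Finset.sum_congr rfl fun a _ => Finset.sum_congr rfl fun b _ => by rw [H.symE 1 b a]
  set c := 2 * κ' / (m * N) with hc
  have hpos : 0 ≤ ∑ a, ∑ b, Matrix.trace ((P a b + P b a - (c * E 1 a b) • E t) *
      (P a b + P b a - (c * E 1 a b) • E t)ᵀ) :=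
    Finset.sum_nonneg fun a _ => Finset.sum_nonneg fun b _ => trace_sq_nonneg _
  have hexp : ∀ a b, Matrix.trace ((P a b + P b a - (c * E 1 a b) • E t) *
      (P a b + P b a - (c * E 1 a b) • E t)ᵀ) =
      2 * Matrix.trace (P a b * P a b) + 2 * Matrix.trace (P a b * P b a) -
      4 * c * (E 1 a b * Matrix.trace (P a b)) + c ^ 2 * mt * (E 1 a b * E 1 a b) := by
    intro a b
    have r : ∀ a b, P a b * E t = P a b := fun a b => by simp only [hP, mul_assoc, H.idem]
    have l : ∀ a b, E t * P a b = P a b := fun a b => by simp only [hP, H.idem']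
    have e1 : Matrix.trace (P b a) = Matrix.trace (P a b) := by
      rw [← hPT, Matrix.trace_transpose]
    have e2 : Matrix.trace (P b a * P b a) = Matrix.trace (P a b * P a b) := by
      rw [← Matrix.trace_transpose, Matrix.transpose_mul, hPT]
    have e3 : Matrix.trace (P b a * P a b) = Matrix.trace (P a b * P b a) := Matrix.trace_mul_comm _ _
    simp only [Matrix.transpose_sub, Matrix.transpose_add, Matrix.transpose_smul, H.sym, hPT,
      Matrix.sub_mul, Matrix.mul_sub, Matrix.add_mul, Matrix.mul_add, Matrix.smul_mul,
      Matrix.mul_smul, r, l, H.idem, Matrix.trace_sub, Matrix.trace_add, Matrix.trace_smul,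
      smul_eq_mul, e1, e2, e3, smul_add]
    ring
  simp only [hexp, Finset.sum_add_distrib, Finset.sum_sub_distrib, ← Finset.mul_sum, hx, hS1, hS2,
    hE] at hpos
  have key : 2 * (N⁻¹ * N⁻¹ * κ' * mt * (κ' - m + κ)) + 2 * (N⁻¹ * N⁻¹ * κ * κ' * mt) -
      4 * c * (N⁻¹ * κ' * mt) + c ^ 2 * mt * m =
      (2 * κ' * mt / (N ^ 2 * m)) * (m * (κ' - m + 2 * κ) - 2 * κ') := by
    rw [hc]; field_simp; ring
  rw [key] at hpos
  have hco : 0 < 2 * κ' * mt / (N ^ 2 * m) := by positivity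
  have := nonneg_of_mul_nonneg_right hpos hco
  linarith

end Core


namespace Core

variable {X : Type*} [Fintype X] [DecidableEq X] {n : ℕ} {N : ℝ}
  {E : ℕ → Matrix X X ℝ} {q : ℕ → ℕ → ℕ → ℝ}

theorem rowC (H : Core n N E q) (C : Finset ℕ) (s : ℕ) :
    ∑ k ∈ C, q 1 k (s + 1) = (if s ∈ C then q 1 s (s + 1) else 0) +
      (if s + 1 ∈ C then q 1 (s + 1) (s + 1) else 0) +
      (if s + 2 ∈ C then q 1 (s + 2) (s + 1) else 0) := by
  have h : ∑ k ∈ ({s, s + 1, s + 2} : Finset ℕ), (if k ∈ C then q 1 k (s + 1) else 0) =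
      ∑ k ∈ C, q 1 k (s + 1) := by
    rw [Finset.sum_ite_mem]
    refine Finset.sum_subset Finset.inter_subset_right fun k hk hk2 => H.q_far ?_
    simp only [Finset.mem_inter, Finset.mem_insert, Finset.mem_singleton, hk, and_true] at hk2
    omega
  rw [← h, Finset.sum_insert (by simp), Finset.sum_pair (by omega)]
  ring

theorem row3 (H : Core n N E q) [Nonempty X] (hN : (Fintype.card X : ℝ) = N) (s : ℕ)
    (hs : s + 1 ≤ n) : q 1 s (s + 1) + q 1 (s + 1) (s + 1) + q 1 (s + 2) (s + 1) =
      Matrix.trace (E 1) := by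
  rw [← H.row_sum hN (s + 1) hs, H.rowC]
  have h1 : s ∈ Finset.range (n + 1) := by simp; omega
  have h2 : s + 1 ∈ Finset.range (n + 1) := by simp; omega
  rw [if_pos h1, if_pos h2]
  split_ifs with h
  · rfl
  · rw [H.qout 1 (s + 2) (s + 1) (by simp at h; omega)]

theorem ne12 (H : Core n N E q) {i j k : ℕ} (h : q i j k ≠ 0) : q j i k ≠ 0 := by
  rwa [H.q_swap12]
theorem ne23 (H : Core n N E q) {i j k : ℕ} (h : q i j k ≠ 0) : q i k j ≠ 0 :=
  fun h0 => h (H.q_zero23 h0)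
theorem ne13 (H : Core n N E q) {i j k : ℕ} (h : q i j k ≠ 0) : q k j i ≠ 0 :=
  fun h0 => h (H.q_zero13 h0)

theorem q0_eq (H : Core n N E q) {k l : ℕ} (h : q 0 k l ≠ 0) : l = k := by
  by_contra hne
  rcases lt_or_gt_of_ne hne with h1 | h1
  · exact H.ne23 h (H.qzero 0 l k (by omega))
  · exact h (H.qzero 0 k l (by omega))

theorem le_of_ne (H : Core n N E q) {i j k : ℕ} (h : q i j k ≠ 0) : i ≤ n ∧ j ≤ n ∧ k ≤ n := by
  by_contra hc
  exact h (H.qout i j k (by omega))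

/-- the case `t = 2` -/
theorem case_two (H : Core n N E q) [Nonempty X] (hN : (Fintype.card X : ℝ) = N) (hn : 3 ≤ n)
    (I : Finset ℕ) (hI0 : 0 ∈ I)
    (hIc : ∀ i ∈ I, ∀ j ∈ I, ∀ k, q i j k ≠ 0 → k ∈ I) (h1 : 1 ∉ I) (h2 : 2 ∈ I) :
    ∀ i, 1 ≤ i → i ≤ n → q 1 i i = 0 := by
  have haI : ∀ j ∈ I, q 1 j j = 0 := by
    intro j hj
    by_contra hne
    exact h1 (hIc j hj j hj 1 (H.ne13 hne |> H.ne12))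
  have ha1 : q 1 1 1 = 0 := H.a1_zero 1 (by omega) (haI 2 h2)
  have hcl : ∀ k ∈ I, ∀ i ∈ I, ∀ l, q i k l ≠ 0 → l ∈ I := fun k hk i hi l h => hIc i hi k hk l h
  have hs1 : ∑ k ∈ I, q 1 k 1 = Matrix.trace (E 1) := by
    have := H.rowC I 0
    simp only [zero_add] at this
    rw [this, if_pos hI0, if_neg h1, if_pos h2, ← H.row3 hN 0 (by omega)]
    simp [ha1]
  have step : ∀ k, 2 * k ∈ I → 2 * k + 1 ≤ n →
      q 1 (2 * k + 1) (2 * k + 1) = 0 ∧ (2 * k + 2 ≤ n → 2 * k + 2 ∈ I) := by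
    intro k hk hkn
    have hc := H.c_pos (2 * k) hkn
    have hodd : 2 * k + 1 ∉ I := by
      intro h
      exact h1 (hIc _ h _ hk 1 (H.ne13 hc.ne'))
    have hcr := H.class_row I I hcl hk (H.ne12 hc.ne')
    rw [hs1, H.rowC, if_pos hk, if_neg hodd, ← H.row3 hN (2 * k) hkn] at hcr
    have hb := H.q_nonneg 1 (2 * k + 2) (2 * k + 1)
    have ha := H.q_nonneg 1 (2 * k + 1) (2 * k + 1)
    split_ifs at hcr with h
    · exact ⟨by linarith, fun _ => h⟩
    · refine ⟨by linarith, fun h' => ?_⟩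
      have := H.b_pos (2 * k + 1) h'
      have e : 2 * k + 1 + 1 = 2 * k + 2 := rfl
      rw [e] at this
      linarith
  have hev : ∀ k, 2 * k ≤ n → 2 * k ∈ I := by
    intro k
    induction k with
    | zero => intro _; simpa using hI0
    | succ k ih =>
      intro h
      have := (step k (ih (by omega)) (by omega)).2 (by omega)
      simpa [mul_add] using this
  intro i _ hi
  rcases Nat.even_or_odd' i with ⟨k, hk | hk⟩
  · exact haI i (by rw [hk]; exact hev k (by omega))
  · rw [hk]; exact (step k (hev k (by omega)) (by omega)).1

/-- the case `t = n` -/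
theorem case_n (H : Core n N E q) (hn : 3 ≤ n)
    (I : Finset ℕ) (hI : ∀ i, i ∈ I ↔ i = 0 ∨ i = n)
    (hIc : ∀ i ∈ I, ∀ j ∈ I, ∀ k, q i j k ≠ 0 → k ∈ I) :
    ∀ i, 1 ≤ i → i ≤ n - 1 → i ≠ n / 2 → q 1 (i + 1) i = q 1 (n - i - 1) (n - i) := by
  have hcl : ∀ i, 2 * i ≤ n → ∀ k ∈ ({i, n - i} : Finset ℕ), ∀ l, q n k l ≠ 0 →
      l ∈ ({i, n - i} : Finset ℕ) := by
    intro i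
    induction i using Nat.strong_induction_on with
    | _ i ih =>
      intro hi k hk l hq
      by_contra hl
      obtain ⟨_, hkn, hln⟩ := H.le_of_ne hq
      simp only [Finset.mem_insert, Finset.mem_singleton] at hk hl
      rcases Nat.eq_zero_or_pos i with h0 | hpos
      · have hkI : k ∈ I := (hI k).2 (by omega)
        have := (hI l).1 (hIc n ((hI n).2 (Or.inr rfl)) k hkI l hq)
        omega
      · by_cases hout : l < i ∨ n - i < l
        · have hj : ∃ j, j < i ∧ (l = j ∨ l = n - j) := by
            rcases hout with h | h
            · exact ⟨l, h, Or.inl rfl⟩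
            · exact ⟨n - l, by omega, by omega⟩
          obtain ⟨j, hji, hlj⟩ := hj
          have := ih j hji (by omega) l (by simpa using hlj) k (H.ne23 hq)
          simp only [Finset.mem_insert, Finset.mem_singleton] at this
          omega
        · obtain ⟨j, rfl⟩ : ∃ j, i = j + 1 := ⟨i - 1, by omega⟩
          have hC : ∀ k ∈ ({j, n - j} : Finset ℕ), ∀ i ∈ I, ∀ l, q i k l ≠ 0 →
              l ∈ ({j, n - j} : Finset ℕ) := by
            intro k hk i hi l h
            rcases (hI i).1 hi with h0 | h0
            · subst h0; rw [H.q0_eq h]; exact hk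
            · subst h0; exact ih j (by omega) (by omega) k hk l h
          have hr := H.class_row _ I hC ((hI n).2 (Or.inr rfl)) hq
          have hz : ∑ x ∈ ({j, n - j} : Finset ℕ), q 1 x l = 0 := by
            refine Finset.sum_eq_zero fun x hx => H.q_far ?_
            simp only [Finset.mem_insert, Finset.mem_singleton] at hx
            omega
          have hp : 0 < ∑ x ∈ ({j, n - j} : Finset ℕ), q 1 x k := by
            refine Finset.sum_pos' (fun x _ => H.q_nonneg _ _ _) ?_
            rcases hk with h | h
            · exact ⟨j, by simp, by rw [h]; exact H.c_pos j (by omega)⟩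
            · refine ⟨n - j, by simp, ?_⟩
              have : n - j = k + 1 := by omega
              rw [this]; exact H.b_pos k (by omega)
          rw [hr, hz] at hp
          exact lt_irrefl _ hp
  have hcl2 : ∀ i, 2 * i ≤ n → ∀ k ∈ ({i, n - i} : Finset ℕ), ∀ i' ∈ I, ∀ l, q i' k l ≠ 0 →
      l ∈ ({i, n - i} : Finset ℕ) := by
    intro i hi k hk i' hi' l h
    rcases (hI i').1 hi' with h0 | h0
    · subst h0; rw [H.q0_eq h]; exact hk
    · subst h0; exact hcl i hi k hk l h
  have hrel : ∀ i, i ≤ n → q n i (n - i) ≠ 0 := by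
    intro i hi
    have h := H.qne i (n - i) (by omega)
    rw [show i + (n - i) = n by omega] at h
    exact H.ne23 (H.ne13 h)
  intro i hi1 hi2 hi3
  rcases lt_or_gt_of_ne hi3 with hlt | hgt
  · have hr := H.class_row _ I (hcl2 (i + 1) (by omega)) ((hI n).2 (Or.inr rfl)) (hrel i (by omega))
    rw [Finset.sum_eq_single (i + 1), Finset.sum_eq_single (n - (i + 1))] at hr
    · rw [hr]; rfl
    · intro k hk hne
      simp only [Finset.mem_insert, Finset.mem_singleton] at hk
      exact H.q_far (by omega)
    · intro h; simp at h
    · intro k hk hne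
      simp only [Finset.mem_insert, Finset.mem_singleton] at hk
      exact H.q_far (by omega)
    · intro h; simp at h
  · obtain ⟨j, hj, hj2⟩ : ∃ j, i = n - (j + 1) ∧ 2 * (j + 1) < n := ⟨n - i - 1, by omega, by omega⟩
    have hr := H.class_row _ I (hcl2 j (by omega)) ((hI n).2 (Or.inr rfl)) (hrel (j + 1) (by omega))
    rw [Finset.sum_eq_single j, Finset.sum_eq_single (n - j)] at hr
    · rw [hj, show n - (j + 1) + 1 = n - j by omega, show n - (n - (j + 1)) - 1 = j by omega,
        show n - (n - (j + 1)) = j + 1 by omega, hr]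
    · intro k hk hne
      simp only [Finset.mem_insert, Finset.mem_singleton] at hk
      exact H.q_far (by omega)
    · intro h; simp at h
    · intro k hk hne
      simp only [Finset.mem_insert, Finset.mem_singleton] at hk
      exact H.q_far (by omega)
    · intro h; simp at h

/-- the case `3 ≤ t < n` -/
theorem case_mid (H : Core n N E q) [Nonempty X] (hN : (Fintype.card X : ℝ) = N)
    (I : Finset ℕ) (hI0 : 0 ∈ I)
    (hIc : ∀ i ∈ I, ∀ j ∈ I, ∀ k, q i j k ≠ 0 → k ∈ I) (r : ℕ) (hr : r + 3 < n)
    (ht : r + 3 ∈ I) (hmin : ∀ k, 1 ≤ k → k < r + 3 → k ∉ I) :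
    (∀ i, 1 ≤ i → i ≤ n → q 1 i i = 0) ∨
    (∀ i, 1 ≤ i → i ≤ n - 1 → i ≠ n / 2 → q 1 (i + 1) i = q 1 (n - i - 1) (n - i)) := by
  set m := Matrix.trace (E 1) with hm
  have hmpos : 0 < m := H.m_pos 1 (by omega)
  have hcl : ∀ k ∈ I, ∀ i ∈ I, ∀ l, q i k l ≠ 0 → l ∈ I := fun k hk i hi l h => hIc i hi k hk l h
  have hat : q 1 (r + 3) (r + 3) = 0 := by
    by_contra hne
    exact hmin 1 le_rfl (by omega) (hIc _ ht _ ht 1 (H.ne13 hne))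
  have hc1 := H.q10 (by omega)
  have hbt : q 1 (r + 3) (r + 2) = 1 := by
    have hc := H.c_pos (r + 2) (by omega)
    have h := H.class_row I I hcl ht (H.ne23 (H.ne13 hc.ne') : q (r + 3) 1 (r + 2) ≠ 0)
    have e1 := H.rowC I 0
    have e2 := H.rowC I (r + 1)
    rw [if_pos hI0, if_neg (hmin _ (by omega) (by omega)), if_neg (hmin _ (by omega) (by omega))] at e1
    rw [if_neg (hmin _ (by omega) (by omega)), if_neg (hmin _ (by omega) (by omega)),
      if_pos (show r + 1 + 2 ∈ I from ht)] at e2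
    have e3 : r + 1 + 2 = r + 3 := rfl
    have e4 : r + 1 + 1 = r + 2 := rfl
    simp only [zero_add, add_zero] at e1
    rw [e3, e4] at e2
    rw [e1, e2, hc1] at h
    linarith
  have hm2 : m ≤ 2 := by
    have h := H.cs_bound hN (by omega) (r + 3) (r + 2) (by omega) (by omega) (by omega) hat
    rw [hbt, ← hm] at h
    have h3 := H.row3 hN (r + 2) (by omega)
    have hb := H.b_pos (r + 3) (by omega)
    have e3 : r + 2 + 1 = r + 3 := rfl
    have e4 : r + 2 + 2 = r + 4 := rfl
    have e5 : r + 3 + 1 = r + 4 := rfl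
    rw [e3, e4, hat, ← hm] at h3
    rw [e5] at hb
    by_contra hc
    push Not at hc
    have : q 1 (r + 2) (r + 3) < m := by linarith
    nlinarith
  have ha1 : q 1 1 1 = 0 := H.a1_zero (r + 2) (by omega) hat
  have Lgen : ∀ t e, t ≤ n → e ≤ n → (e + 1 = t ∨ e = t + 1) → q 1 t t = 0 → m / 2 ≤ q 1 t e := by
    intro t e h1 h2 h3 h4
    have h := H.cs_bound hN (by omega) t e h1 h2 h3 h4
    rw [← hm] at h
    have hk := H.q_nonneg 1 e t
    have : 0 ≤ m * (2 * q 1 t e - m) := by nlinarith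
    have := nonneg_of_mul_nonneg_right this hmpos
    linarith
  have hdim3 : ∀ j, 1 ≤ j → j ≤ n → q 1 j j ≠ 0 →
      Matrix.trace (E (j - 1)) + Matrix.trace (E j) + (if j + 1 ≤ n then Matrix.trace (E (j + 1)) else 0)
        ≤ 2 * Matrix.trace (E j) := by
    intro j h1 h2 h3
    obtain ⟨s, rfl⟩ : ∃ s, j = s + 1 := ⟨j - 1, by omega⟩
    have hd := H.dim_bound (s + 1)
    have hnn : ∀ k ∈ Finset.range (n + 1), 0 ≤ (if q 1 (s + 1) k = 0 then 0 else Matrix.trace (E k)) := by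
      intro k hk
      split_ifs
      · exact le_rfl
      · exact (H.m_pos k (by simp at hk; omega)).le
    have hmj := H.m_pos (s + 1) h2
    have e : m * Matrix.trace (E (s + 1)) ≤ 2 * Matrix.trace (E (s + 1)) := by nlinarith
    rw [← hm] at hd
    refine le_trans ?_ (le_trans hd e)
    have hs0 := (H.b_pos s h2).ne'
    simp only [Nat.add_sub_cancel]
    split_ifs with h
    · have hs2 := (H.c_pos (s + 1) h).ne'
      have hsub : ({s, s + 1, s + 1 + 1} : Finset ℕ) ⊆ Finset.range (n + 1) := by
        intro k hk; simp at hk ⊢; omega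
      refine le_trans ?_ (Finset.sum_le_sum_of_subset_of_nonneg hsub fun k hk _ => hnn k hk)
      rw [Finset.sum_insert (by simp; omega), Finset.sum_pair (by omega), if_neg hs0, if_neg h3, if_neg hs2]
      linarith
    · have hsub : ({s, s + 1} : Finset ℕ) ⊆ Finset.range (n + 1) := by
        intro k hk; simp at hk ⊢; omega
      refine le_trans ?_ (Finset.sum_le_sum_of_subset_of_nonneg hsub fun k hk _ => hnn k hk)
      rw [Finset.sum_pair (by omega), if_neg hs0, if_neg h3]
      linarith
  have ha : ∀ j, 1 ≤ j → j + 1 ≤ n → q 1 j j = 0 := by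
    intro j
    induction j using Nat.strong_induction_on with
    | _ j ih =>
      intro h1 h2
      rcases (show j = 1 ∨ 2 ≤ j by omega) with h | h
      · rw [h]; exact ha1
      · obtain ⟨s, rfl⟩ : ∃ s, j = s + 2 := ⟨j - 2, by omega⟩
        have a1 := ih (s + 1) (by omega) (by omega) (by omega)
        have c2 := Lgen (s + 1) (s + 2) (by omega) (by omega) (by omega) a1
        have c1 : m / 2 ≤ q 1 s (s + 1) := by
          rcases Nat.eq_zero_or_pos s with h0 | h0
          · rw [h0, zero_add, hc1]; linarith
          · exact Lgen s (s + 1) (by omega) (by omega) (by omega) (ih s (by omega) h0 (by omega))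
        have hrow := H.row3 hN s (by omega)
        rw [a1, ← hm] at hrow
        have hsw := H.q_swap23 1 (s + 1) (s + 2)
        have p1 := H.m_pos (s + 1) (by omega)
        have p2 := H.m_pos (s + 2) (by omega)
        have p3 := H.m_pos (s + 3) (by omega)
        by_contra hne
        have hd := hdim3 (s + 2) (by omega) (by omega) hne
        rw [if_pos h2, show s + 2 - 1 = s + 1 by omega, show s + 2 + 1 = s + 3 by omega] at hd
        have hb : q 1 (s + 2) (s + 1) ≤ m / 2 := by linarith
        have hle : m / 2 * Matrix.trace (E (s + 2)) ≤ m / 2 * Matrix.trace (E (s + 1)) := by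
          nlinarith
        have := le_of_mul_le_mul_left hle (by linarith)
        linarith
  have hrow1 := H.row3 hN 0 (by omega)
  simp only [zero_add] at hrow1
  rw [hc1, ha1, ← hm] at hrow1
  have hb1 := Lgen 2 1 (by omega) (by omega) (by omega) (ha 2 (by omega) (by omega))
  have hmeq : m = 2 := by linarith
  have hcge : ∀ s, s + 1 ≤ n → 1 ≤ q 1 s (s + 1) := by
    intro s hs
    rcases Nat.eq_zero_or_pos s with h0 | h0
    · rw [h0, zero_add, hc1]
    · have := Lgen s (s + 1) (by omega) (by omega) (by omega) (ha s h0 (by omega))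
      linarith
  by_cases han : q 1 n n = 0
  · left
    intro i h1 h2
    rcases (show i = n ∨ i + 1 ≤ n by omega) with h | h
    · rw [h]; exact han
    · exact ha i h1 h
  · right
    have hbge : ∀ s, s + 2 ≤ n → 1 ≤ q 1 (s + 2) (s + 1) := by
      intro s hs
      rcases (show s + 3 ≤ n ∨ s + 2 = n by omega) with h | h
      · have := Lgen (s + 2) (s + 1) (by omega) (by omega) (by omega) (ha (s + 2) (by omega) (by omega))
        linarith
      · have hd := hdim3 n (by omega) le_rfl han
        rw [if_neg (by omega), ← h, show s + 2 - 1 = s + 1 by omega] at hd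
        have hsw := H.q_swap23 1 (s + 1) (s + 2)
        have p1 := H.m_pos (s + 1) (by omega)
        have p2 := H.m_pos (s + 2) (by omega)
        have c := hcge (s + 1) (by omega)
        have e : s + 1 + 1 = s + 2 := rfl
        rw [e] at c
        by_contra hc
        push Not at hc
        nlinarith
    have hone : ∀ s, s + 2 ≤ n → q 1 (s + 2) (s + 1) = 1 ∧ q 1 s (s + 1) = 1 := by
      intro s hs
      have h1 := hbge s hs
      have h2 := hcge s (by omega)
      have h3 := H.row3 hN s (by omega)
      rw [ha (s + 1) (by omega) (by omega), ← hm] at h3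
      constructor <;> linarith
    intro i h1 h2 _
    obtain ⟨s, rfl⟩ : ∃ s, i = s + 1 := ⟨i - 1, by omega⟩
    obtain ⟨u, hu⟩ : ∃ u, n - (s + 1) = u + 1 := ⟨n - (s + 1) - 1, by omega⟩
    rw [hu, Nat.add_sub_cancel, (hone u (by omega)).2]
    exact (hone s (by omega)).1

theorem final (H : Core n N E q) [Nonempty X] (hN : (Fintype.card X : ℝ) = N) (hn : 3 ≤ n)
    (I : Finset ℕ) (hI0 : 0 ∈ I) (hIn : ∀ i ∈ I, i ≤ n)
    (hIc : ∀ i ∈ I, ∀ j ∈ I, ∀ k, q i j k ≠ 0 → k ∈ I) (hIt : ∃ t ∈ I, t ≠ 0)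
    (hIne : ∃ k ≤ n, k ∉ I) :
    (∀ i, 1 ≤ i → i ≤ n → q 1 i i = 0) ∨
    (∀ i, 1 ≤ i → i ≤ n - 1 → i ≠ n / 2 → q 1 (i + 1) i = q 1 (n - i - 1) (n - i)) := by
  have h1 : 1 ∉ I := by
    intro h1
    obtain ⟨k, hk, hkI⟩ := hIne
    have : ∀ j, j ≤ n → j ∈ I := by
      intro j
      induction j with
      | zero => intro _; exact hI0
      | succ j ih => intro h; exact hIc 1 h1 j (ih (by omega)) _ (H.c_pos j h).ne'
    exact hkI (this k hk)
  classical
  obtain ⟨t, ⟨htI, ht0⟩, hmin⟩ : ∃ t, (t ∈ I ∧ t ≠ 0) ∧ ∀ k, k < t → ¬ (k ∈ I ∧ k ≠ 0) :=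
    ⟨Nat.find hIt, Nat.find_spec hIt, fun k hk => Nat.find_min hIt hk⟩
  have htn := hIn t htI
  have ht1 : t ≠ 1 := fun h => h1 (h ▸ htI)
  rcases (show t = 2 ∨ t = n ∨ (3 ≤ t ∧ t < n) by omega) with h | h | h
  · left
    exact H.case_two hN hn I hI0 hIc h1 (h ▸ htI)
  · right
    refine H.case_n hn I (fun i => ⟨fun hi => ?_, fun hi => ?_⟩) hIc
    · by_contra hc
      have := hIn i hi
      exact hmin i (by omega) ⟨hi, by omega⟩
    · rcases hi with hi | hi
      · rw [hi]; exact hI0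
      · rw [hi, ← h]; exact htI
  · obtain ⟨r, rfl⟩ : ∃ r, t = r + 3 := ⟨t - 3, by omega⟩
    exact H.case_mid hN I hI0 hIc r (by omega) htI fun k hk1 hk2 hkI => hmin k hk2 ⟨hkI, by omega⟩

end Core


namespace Core

variable {X : Type*} [Fintype X] [DecidableEq X] {n : ℕ} {N : ℝ}
  {E : ℕ → Matrix X X ℝ} {q : ℕ → ℕ → ℕ → ℝ}

/-- A disconnected relation yields a nontrivial closed set of idempotent indices. -/
theorem exists_I (H : Core n N E q) (A : Matrix X X ℝ) (P : ℕ → ℝ)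
    (h01 : ∀ x y, A x y = 0 ∨ A x y = 1) (hsym : ∀ x y, A x y = A y x) (hdiag : ∀ x, A x x = 0)
    (hne : A ≠ 0) (hAE : ∀ j, A * E j = P j • E j)
    (hdis : ¬ ∀ x y, Relation.EqvGen (fun a b => A a b = 1) x y) :
    ∃ I : Finset ℕ, 0 ∈ I ∧ (∀ i ∈ I, i ≤ n) ∧
      (∀ i ∈ I, ∀ j ∈ I, ∀ k, q i j k ≠ 0 → k ∈ I) ∧ (∃ t ∈ I, t ≠ 0) ∧ (∃ k ≤ n, k ∉ I) := by
  classical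
  set κ := P 0 with hκ
  push Not at hdis
  obtain ⟨x0, y0, hxy⟩ := hdis
  have hNi := (inv_pos.2 H.Npos).ne'
  have hrow : ∀ x, ∑ y, A x y = κ := by
    intro x
    have h := congrFun (congrFun (hAE 0) x) x
    rw [Matrix.mul_apply] at h
    simp only [H.zero, Matrix.smul_apply, smul_eq_mul, ← Finset.sum_mul] at h
    exact mul_right_cancel₀ hNi h
  have hcol : ∀ y, ∑ x, A x y = κ := by
    intro y
    rw [← hrow y]
    exact Finset.sum_congr rfl fun x _ => hsym x y
  have hnn : ∀ x y, 0 ≤ A x y := by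
    intro x y; rcases h01 x y with h | h <;> rw [h] <;> norm_num
  have hconst : ∀ j, P j = κ → ∀ z x y, A x y = 1 → E j x z = E j y z := by
    intro j hj z
    set f : X → ℝ := fun x => E j x z with hf
    have hAf : ∀ x, ∑ y, A x y * f y = κ * f x := by
      intro x
      have h := congrFun (congrFun (hAE j) x) z
      rw [Matrix.mul_apply] at h
      simpa [hj] using h
    have hs : ∑ x, ∑ y, A x y * (f x - f y) ^ 2 = 0 := by
      have e : ∀ x y, A x y * (f x - f y) ^ 2 =
          f x ^ 2 * A x y - 2 * (f x * (A x y * f y)) + f y ^ 2 * A x y := fun x y => by ring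
      simp only [e, Finset.sum_add_distrib, Finset.sum_sub_distrib, ← Finset.mul_sum, hAf, hrow]
      rw [Finset.sum_comm (f := fun x y => f y ^ 2 * A x y)]
      simp only [← Finset.mul_sum, hcol]
      rw [← Finset.sum_mul, Finset.mul_sum, Finset.sum_mul, ← Finset.sum_sub_distrib,
        ← Finset.sum_add_distrib]
      exact Finset.sum_eq_zero fun x _ => by ring
    intro x y hxy
    have h1 := (Finset.sum_eq_zero_iff_of_nonneg (f := fun x => ∑ y, A x y * (f x - f y) ^ 2)
      (fun x _ => Finset.sum_nonneg fun y _ => mul_nonneg (hnn x y) (sq_nonneg _))).1 hs x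
        (Finset.mem_univ _)
    have h2 := (Finset.sum_eq_zero_iff_of_nonneg (f := fun y => A x y * (f x - f y) ^ 2)
      (fun y _ => mul_nonneg (hnn x y) (sq_nonneg _))).1 h1 y (Finset.mem_univ _)
    simp only [hxy, one_mul] at h2
    have := pow_eq_zero_iff (two_ne_zero) |>.1 h2
    exact sub_eq_zero.1 this
  refine ⟨(Finset.range (n + 1)).filter fun j => P j = κ, by simp [hκ], ?_, ?_, ?_, ?_⟩
  · intro i hi; simp at hi; omega
  · intro i hi j hj k hq
    simp only [Finset.mem_filter, Finset.mem_range] at hi hj ⊢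
    have hk := (H.le_of_ne hq).2.2
    refine ⟨by omega, ?_⟩
    have hAG : A * Matrix.hadamard (E i) (E j) = κ • Matrix.hadamard (E i) (E j) := by
      ext x z
      rw [Matrix.mul_apply, Matrix.smul_apply, smul_eq_mul, ← hrow x, Finset.sum_mul]
      refine Finset.sum_congr rfl fun y _ => ?_
      rcases h01 x y with h | h
      · rw [h]; simp
      · rw [Matrix.hadamard_apply, Matrix.hadamard_apply, hconst i hi.2 z x y h,
          hconst j hj.2 z x y h]
    have h := congrArg (· * E k) hAG
    simp only [mul_assoc, Matrix.smul_mul, H.had_mul, Matrix.mul_smul, hAE, smul_smul] at h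
    have h2 := smul_left_injective ℝ (H.ne k hk) h
    have h3 : N⁻¹ * q i j k ≠ 0 := mul_ne_zero hNi hq
    apply mul_left_cancel₀ h3
    have h2a : N⁻¹ * (q i j k * P k) = κ * (N⁻¹ * q i j k) := h2
    have h2' : N⁻¹ * q i j k * P k = κ * (N⁻¹ * q i j k) := by rw [mul_assoc]; exact h2a
    rw [h2', mul_comm]
  · by_contra hc
    push Not at hc
    set χ : X → ℝ := fun u => if Relation.EqvGen (fun a b => A a b = 1) x0 u then 1 else 0 with hχ
    have hAχ : A *ᵥ χ = κ • χ := by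
      ext x
      simp only [Matrix.mulVec, dotProduct, Pi.smul_apply, smul_eq_mul]
      rw [← hrow x, Finset.sum_mul]
      refine Finset.sum_congr rfl fun y _ => ?_
      rcases h01 x y with h | h
      · rw [h]; simp
      · have hr : Relation.EqvGen (fun a b => A a b = 1) x y := Relation.EqvGen.rel x y h
        have : Relation.EqvGen (fun a b => A a b = 1) x0 y ↔
            Relation.EqvGen (fun a b => A a b = 1) x0 x :=
          ⟨fun h' => h'.trans _ _ _ (hr.symm _ _),
            fun h' => h'.trans _ _ _ hr⟩
        simp only [hχ, this]
    have hEA : ∀ j, E j * A = P j • E j := by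
      intro j
      have := congrArg Matrix.transpose (hAE j)
      have hAT : Aᵀ = A := by ext x y; exact hsym y x
      rwa [Matrix.transpose_mul, Matrix.transpose_smul, H.sym, hAT] at this
    have hz : ∀ j ∈ Finset.range (n + 1), j ≠ 0 → E j *ᵥ χ = 0 := by
      intro j hj hj0
      have h1 : E j *ᵥ (A *ᵥ χ) = P j • (E j *ᵥ χ) := by
        rw [Matrix.mulVec_mulVec, hEA, Matrix.smul_mulVec]
      rw [hAχ, Matrix.mulVec_smul] at h1
      by_contra h0
      have := smul_left_injective ℝ h0 h1
      exact hj0 (hc j (by simp only [Finset.mem_filter]; exact ⟨hj, this.symm⟩))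
    have hχE : χ = E 0 *ᵥ χ := by
      have h1 : χ = (∑ i ∈ Finset.range (n + 1), E i) *ᵥ χ := by rw [H.sum, Matrix.one_mulVec]
      rw [Matrix.sum_mulVec, Finset.sum_eq_single 0 hz (by simp)] at h1
      exact h1
    have e1 : χ x0 = χ y0 := by
      rw [hχE]
      simp only [Matrix.mulVec, dotProduct, H.zero]
    simp only [hχ, if_pos (Relation.EqvGen.refl x0), if_neg hxy] at e1
    exact one_ne_zero e1
  · by_contra hc
    push Not at hc
    have hA : A = κ • (1 : Matrix X X ℝ) := by
      calc A = A * ∑ i ∈ Finset.range (n + 1), E i := by rw [H.sum, mul_one]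
        _ = ∑ i ∈ Finset.range (n + 1), κ • E i := by
            rw [Finset.mul_sum]
            refine Finset.sum_congr rfl fun i hi => ?_
            have := hc i (by simp at hi; omega)
            simp only [Finset.mem_filter] at this
            rw [hAE, this.2]
        _ = _ := by rw [← Finset.smul_sum, H.sum]
    have h0 := hdiag x0
    rw [hA] at h0
    simp at h0
    exact hne (by rw [hA, h0, zero_smul])

end Core


section Bridge

variable {X : Type*} [Fintype X] [DecidableEq X] {n : ℕ}

theorem E_T (S : Scheme X n) (hsym : S.IsSym) (i : Fin (n + 1)) : (S.E i)ᵀ = S.E i := by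
  have h := S.E_span i
  refine Submodule.span_induction (p := fun M _ => Mᵀ = M) ?_ ?_ ?_ ?_ h
  · rintro _ ⟨j, rfl⟩; exact hsym j
  · simp
  · intro M M' _ _ h1 h2; rw [Matrix.transpose_add, h1, h2]
  · intro c M _ h1; rw [Matrix.transpose_smul, h1]

theorem E_real (S : Scheme X n) (hsym : S.IsSym) (i : Fin (n + 1)) (x y : X) :
    ((S.E i x y).re : ℂ) = S.E i x y := by
  rw [← Complex.conj_eq_iff_re]
  have h1 := congrFun (congrFun (S.E_herm i) y) x
  have h2 := congrFun (congrFun (E_T S hsym i) y) x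
  rw [Matrix.conjTranspose_apply] at h1
  rw [Matrix.transpose_apply] at h2
  exact h1.trans h2.symm

theorem E_im (S : Scheme X n) (hsym : S.IsSym) (i : Fin (n + 1)) (x y : X) :
    (S.E i x y).im = 0 := by
  rw [← E_real S hsym i x y, Complex.ofReal_im]

theorem mul_had_c (S : Scheme X n) {q : Fin (n + 1) → Fin (n + 1) → Fin (n + 1) → ℂ}
    (hq : S.IsKrein q) (i j k : Fin (n + 1)) :
    S.E k * Matrix.hadamard (S.E i) (S.E j) = ((Fintype.card X : ℂ)⁻¹ * q i j k) • S.E k := by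
  rw [hq i j, Matrix.mul_smul, Finset.mul_sum, mul_smul]
  congr 1
  rw [Finset.sum_eq_single k]
  · rw [Matrix.mul_smul, S.E_mul, if_pos rfl]
  · intro b _ hb
    rw [Matrix.mul_smul, S.E_mul, if_neg (Ne.symm hb), smul_zero]
  · simp

theorem exists_entry (S : Scheme X n) (k : Fin (n + 1)) : ∃ x y, S.E k x y ≠ 0 := by
  by_contra hc
  push Not at hc
  exact S.E_ne k (by ext x y; simpa using hc x y)

theorem q_real [Nonempty X] (S : Scheme X n) (hsym : S.IsSym)
    {q : Fin (n + 1) → Fin (n + 1) → Fin (n + 1) → ℂ}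
    (hq : S.IsKrein q) (i j k : Fin (n + 1)) : ((q i j k).re : ℂ) = q i j k := by
  obtain ⟨x, y, hxy⟩ := exists_entry S k
  have h := congrFun (congrFun (mul_had_c S hq i j k) x) y
  rw [Matrix.mul_apply, Matrix.smul_apply, smul_eq_mul] at h
  have hc : (Fintype.card X : ℂ) ≠ 0 := by exact_mod_cast Fintype.card_ne_zero
  have hv : q i j k = (Fintype.card X : ℂ) *
      (∑ z, S.E k x z * Matrix.hadamard (S.E i) (S.E j) z y) / S.E k x y := by
    rw [h]; field_simp
  rw [← Complex.conj_eq_iff_re, hv]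
  simp only [Matrix.hadamard_apply, map_div₀, map_mul, map_sum, map_natCast,
    Complex.conj_eq_iff_im.2 (E_im S hsym _ _ _)]

/-- real idempotents with natural index -/
noncomputable def Er (S : Scheme X n) (j : ℕ) : Matrix X X ℝ :=
  if h : j < n + 1 then Matrix.of fun x y => (S.E ⟨j, h⟩ x y).re else 0

/-- real Krein parameters with natural index -/
noncomputable def qr (q : Fin (n + 1) → Fin (n + 1) → Fin (n + 1) → ℂ) (i j k : ℕ) : ℝ :=
  if h : i < n + 1 ∧ j < n + 1 ∧ k < n + 1 then (q ⟨i, h.1⟩ ⟨j, h.2.1⟩ ⟨k, h.2.2⟩).re else 0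

theorem Er_fin (S : Scheme X n) (j : Fin (n + 1)) (x y : X) : Er S j x y = (S.E j x y).re := by
  simp [Er, j.isLt]

theorem qr_fin (q : Fin (n + 1) → Fin (n + 1) → Fin (n + 1) → ℂ) (i j k : Fin (n + 1)) :
    qr q i j k = (q i j k).re := by
  simp only [qr]
  rw [dif_pos ⟨i.isLt, j.isLt, k.isLt⟩]

theorem Er_out (S : Scheme X n) (j : ℕ) (h : n < j) : Er S j = 0 := by
  simp [Er, show ¬ j < n + 1 by omega]

theorem core [Nonempty X] (S : Scheme X n) (hsym : S.IsSym)
    (q : Fin (n + 1) → Fin (n + 1) → Fin (n + 1) → ℂ) (hcom : S.Cometric q) :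
    Core n (Fintype.card X : ℝ) (Er S) (qr q) := by
  obtain ⟨hq, hqz⟩ := hcom
  have lift : ∀ j : ℕ, j ≤ n → ∃ j' : Fin (n + 1), (j' : ℕ) = j := fun j hj => ⟨⟨j, by omega⟩, rfl⟩
  have qreal := q_real S hsym hq
  refine ⟨?_, ?_, ?_, ?_, ?_, ?_, ?_, ?_, ?_, ?_, ?_⟩
  · exact_mod_cast Fintype.card_pos
  · intro i
    by_cases hi : i ≤ n
    · obtain ⟨i, rfl⟩ := lift i hi
      ext x y
      rw [Matrix.transpose_apply, Er_fin, Er_fin]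
      have := congrFun (congrFun (E_T S hsym i) x) y
      rw [Matrix.transpose_apply] at this
      rw [this]
    · rw [Er_out S i (by omega)]; simp
  · intro i j
    by_cases hi : i ≤ n
    · by_cases hj : j ≤ n
      · obtain ⟨i, rfl⟩ := lift i hi
        obtain ⟨j, rfl⟩ := lift j hj
        ext x y
        have := congrArg Complex.re (congrFun (congrFun (S.E_mul i j) x) y)
        rw [Matrix.mul_apply, Complex.re_sum] at this
        simp only [Complex.mul_re, E_im S hsym, mul_zero, sub_zero] at this
        rw [Matrix.mul_apply]
        simp only [Er_fin]
        rw [this]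
        by_cases hij : i = j
        · subst hij; simp [Er_fin]
        · have : (i : ℕ) ≠ j := fun h => hij (Fin.ext h)
          simp [hij, this]
      · rw [Er_out S j (by omega), mul_zero, if_neg (by omega)]
    · rw [Er_out S i (by omega), zero_mul]; simp
  · rw [Finset.sum_range]
    ext x y
    have := congrArg Complex.re (congrFun (congrFun S.E_sum x) y)
    rw [Matrix.sum_apply, Complex.re_sum] at this
    rw [Matrix.sum_apply]
    simp only [Er_fin]
    rw [this, Matrix.one_apply, Matrix.one_apply]
    split_ifs <;> simp
  · intro u v
    have := Er_fin S 0 u v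
    simp only [Fin.val_zero] at this
    rw [this, S.E_zero]
    have : ((Fintype.card X : ℂ)⁻¹).re = (Fintype.card X : ℝ)⁻¹ := by
      rw [← Complex.ofReal_natCast, ← Complex.ofReal_inv, Complex.ofReal_re]
    simpa using this
  · intro i hi h0
    obtain ⟨i, rfl⟩ := lift i hi
    apply S.E_ne i
    ext x y
    rw [← E_real S hsym, ← Er_fin, h0]; simp
  · exact fun i hi => Er_out S i hi
  · intro i j k h
    simp only [qr]
    rw [dif_neg (by omega)]
  · intro i j
    by_cases hi : i ≤ n
    · by_cases hj : j ≤ n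
      · obtain ⟨i, rfl⟩ := lift i hi
        obtain ⟨j, rfl⟩ := lift j hj
        rw [Finset.sum_range]
        ext x y
        have := congrFun (congrFun (hq i j) x) y
        simp only [Matrix.hadamard_apply, Matrix.smul_apply, Matrix.sum_apply, smul_eq_mul] at this ⊢
        simp only [Er_fin, qr_fin]
        apply Complex.ofReal_injective
        push_cast
        simp only [E_real S hsym, qreal]
        exact this
      · rw [Er_out S j (by omega)]
        have : ∀ k, qr q i j k = 0 := fun k => by simp only [qr]; rw [dif_neg (by omega)]
        simp [this]
    · rw [Er_out S i (by omega)]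
      have : ∀ k, qr q i j k = 0 := fun k => by simp only [qr]; rw [dif_neg (by omega)]
      simp [this]
  · intro i j k h
    by_cases hh : i < n + 1 ∧ j < n + 1 ∧ k < n + 1
    · simp only [qr]
      rw [dif_pos hh, (hqz _ _ _).1 h]; simp
    · simp only [qr]
      rw [dif_neg hh]
  · intro i j h h0
    have hh : i < n + 1 ∧ j < n + 1 ∧ i + j < n + 1 := by omega
    simp only [qr] at h0
    rw [dif_pos hh] at h0
    apply (hqz ⟨i, hh.1⟩ ⟨j, hh.2.1⟩ ⟨i + j, hh.2.2⟩).2 rfl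
    rw [← qreal, h0]; simp

theorem E_li (S : Scheme X n) : LinearIndependent ℂ S.E := by
  rw [Fintype.linearIndependent_iff]
  intro g hg k
  have h := congrArg (S.E k * ·) hg
  simp only [Finset.mul_sum, Matrix.mul_smul, S.E_mul, mul_zero] at h
  rw [Finset.sum_eq_single k] at h
  · rw [if_pos rfl] at h
    rcases smul_eq_zero.1 h with h | h
    · exact h
    · exact absurd h (S.E_ne k)
  · intro b _ hb; rw [if_neg (Ne.symm hb), smul_zero]
  · simp

theorem span_le (S : Scheme X n) :
    Submodule.span ℂ (Set.range S.E) ≤ Submodule.span ℂ (Set.range S.A) := by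
  rw [Submodule.span_le]
  rintro _ ⟨i, rfl⟩
  exact S.E_span i

theorem span_eq (S : Scheme X n) :
    Submodule.span ℂ (Set.range S.E) = Submodule.span ℂ (Set.range S.A) := by
  refine Submodule.eq_of_le_of_finrank_le (span_le S) ?_
  rw [finrank_span_eq_card (E_li S)]
  exact finrank_range_le_card S.A

theorem A_ne (S : Scheme X n) (i : Fin (n + 1)) : S.A i ≠ 0 := by
  have : LinearIndependent ℂ S.A := by
    rw [linearIndependent_iff_card_eq_finrank_span, Set.finrank, ← span_eq,
      finrank_span_eq_card (E_li S)]
  exact this.ne_zero i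

theorem A_E (S : Scheme X n) (i j : Fin (n + 1)) : ∃ c : ℂ, S.A i * S.E j = c • S.E j := by
  have h : S.A i ∈ Submodule.span ℂ (Set.range S.E) := by
    rw [span_eq]; exact Submodule.subset_span ⟨i, rfl⟩
  obtain ⟨c, hc⟩ := (Submodule.mem_span_range_iff_exists_fun ℂ).1 h
  refine ⟨c j, ?_⟩
  rw [← hc, Finset.sum_mul, Finset.sum_eq_single j]
  · rw [Matrix.smul_mul, S.E_mul, if_pos rfl]
  · intro b _ hb; rw [Matrix.smul_mul, S.E_mul, if_neg hb, smul_zero]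
  · simp

theorem A_diag (S : Scheme X n) (i : Fin (n + 1)) (hi : i ≠ 0) (x : X) : S.A i x x = 0 := by
  rcases S.A_zeroOne i x x with h | h
  · exact h
  exfalso
  have h1 := congrArg Complex.re (congrFun (congrFun S.A_sum x) x)
  rw [Matrix.sum_apply, Complex.re_sum] at h1
  have h2 : ∑ k ∈ ({0, i} : Finset (Fin (n + 1))), (S.A k x x).re ≤ ∑ k, (S.A k x x).re := by
    refine Finset.sum_le_sum_of_subset_of_nonneg (Finset.subset_univ _) fun k _ _ => ?_
    rcases S.A_zeroOne k x x with h | h <;> rw [h] <;> simp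
  rw [h1, Finset.sum_pair (Ne.symm hi), h, S.A_zero] at h2
  norm_num at h2

theorem main_real [Nonempty X] (S : Scheme X n) (hsym : S.IsSym)
    (q : Fin (n + 1) → Fin (n + 1) → Fin (n + 1) → ℂ) (hcom : S.Cometric q)
    (himp : S.Imprimitive) (hn : 3 ≤ n) :
    (∀ i, 1 ≤ i → i ≤ n → qr q 1 i i = 0) ∨
    (∀ i, 1 ≤ i → i ≤ n - 1 → i ≠ n / 2 → qr q 1 (i + 1) i = qr q 1 (n - i - 1) (n - i)) := by
  have H := core S hsym q hcom
  obtain ⟨i0, hi0, hdis⟩ := himp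
  choose c hc using fun j => A_E S i0 j
  have hAim : ∀ x y, (S.A i0 x y).im = 0 := by
    intro x y; rcases S.A_zeroOne i0 x y with h | h <;> rw [h] <;> simp
  have hAre : ∀ x y, ((S.A i0 x y).re : ℂ) = S.A i0 x y := by
    intro x y; rcases S.A_zeroOne i0 x y with h | h <;> rw [h] <;> simp
  have hex := H.exists_I (Matrix.of fun x y => (S.A i0 x y).re)
    (fun j => if h : j < n + 1 then (c ⟨j, h⟩).re else 0)
  suffices hs : ∃ I : Finset ℕ, 0 ∈ I ∧ (∀ i ∈ I, i ≤ n) ∧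
      (∀ i ∈ I, ∀ j ∈ I, ∀ k, qr q i j k ≠ 0 → k ∈ I) ∧ (∃ t ∈ I, t ≠ 0) ∧
      (∃ k ≤ n, k ∉ I) by
    obtain ⟨I, h0, hIn, hIc, hIt, hIne⟩ := hs
    exact H.final rfl hn I h0 hIn hIc hIt hIne
  refine hex ?_ ?_ ?_ ?_ ?_ ?_
  · intro x y
    rcases S.A_zeroOne i0 x y with h | h
    · left; simp [h]
    · right; simp [h]
  · intro x y
    have := congrFun (congrFun (hsym i0) x) y
    rw [Matrix.transpose_apply] at this
    simp [this]
  · intro x; simp [A_diag S i0 hi0 x]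
  · intro h
    apply A_ne S i0
    ext x y
    have := congrFun (congrFun h x) y
    simp only [Matrix.of_apply, Matrix.zero_apply] at this
    rw [← hAre, this]; simp
  · intro j
    by_cases hj : j < n + 1
    · simp only [hj, dif_pos]
      ext x y
      have := congrArg Complex.re (congrFun (congrFun (hc ⟨j, hj⟩) x) y)
      rw [Matrix.mul_apply, Complex.re_sum, Matrix.smul_apply, smul_eq_mul] at this
      simp only [Complex.mul_re, E_im S hsym, mul_zero, sub_zero] at this
      rw [Matrix.mul_apply, Matrix.smul_apply, smul_eq_mul]
      have e := fun x y => Er_fin S ⟨j, hj⟩ x y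
      simp only at e
      simp only [e, Matrix.of_apply]
      exact this
    · rw [Er_out S j (by omega)]; simp
  · intro hall
    apply hdis
    intro x y
    have := hall x y
    have e : (fun a b => S.A i0 a b = 1) =
        fun a b => (Matrix.of fun x y => (S.A i0 x y).re : Matrix X X ℝ) a b = 1 := by
      funext a b
      rcases S.A_zeroOne i0 a b with h | h <;> simp [h]
    rw [e]; exact this

end Bridge


/-- Suzuki: an imprimitive cometric scheme is Q-bipartite, Q-antipodal,
or one of two exceptional cases with n = 4 or n = 6.  Here, with Krein parameters `q`,
we write `a*_i = q 1 i i`, `b*_i = q 1 (i+1) i`, `c*_i = q 1 (i-1) i` and `m = m_1 = Q 0 1`. -/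
theorem suzuki_imprimitive_cometric {X : Type*} [Fintype X] [DecidableEq X] [Nonempty X]
    {n : ℕ} (hn : 1 ≤ n) (S : Scheme X n) (hsym : S.IsSym)
    (q : Fin (n + 1) → Fin (n + 1) → Fin (n + 1) → ℂ) (hcom : S.Cometric q)
    (Q : Matrix (Fin (n + 1)) (Fin (n + 1)) ℂ) (hQ : S.IsQ Q)
    (himp : S.Imprimitive) :
    -- (i) Q-bipartite: a*_i = 0 for all 1 ≤ i ≤ n
    (∀ i : Fin (n + 1), i ≠ 0 → q 1 i i = 0) ∨
    -- (ii) Q-antipodal: b*_i = c*_{n-i} for 1 ≤ i ≤ n-1, i ≠ ⌊n/2⌋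
    (∀ i : ℕ, 1 ≤ i → i ≤ n - 1 → i ≠ n / 2 →
      q 1 ((i + 1 : ℕ) : Fin (n + 1)) ((i : ℕ) : Fin (n + 1)) =
        q 1 ((n - i - 1 : ℕ) : Fin (n + 1)) ((n - i : ℕ) : Fin (n + 1))) ∨
    -- (iii) n = 4 exceptional case
    (n = 4 ∧ q 1 1 0 = Q 0 1 ∧ q 1 2 1 = Q 0 1 - 1 ∧ q 1 3 2 = 1 ∧
      q 1 0 1 = 1 ∧ q 1 2 3 = Q 0 1 - q 1 4 3 ∧ q 1 3 4 = 1 ∧ 0 < q 1 2 2) ∨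
    -- (iv) n = 6 exceptional case
    (n = 6 ∧ q 1 1 0 = Q 0 1 ∧ q 1 2 1 = Q 0 1 - 1 ∧ q 1 3 2 = 1 ∧ q 1 6 5 = 1 ∧
      q 1 0 1 = 1 ∧ q 1 2 3 = Q 0 1 - q 1 4 3 ∧ q 1 3 4 = 1 ∧ q 1 5 6 = Q 0 1 ∧
      q 1 2 2 = q 1 4 4 + q 1 5 5 ∧ 0 < q 1 2 2) := by
  have qreal := q_real S hsym hcom.1
  rcases (show n ≤ 2 ∨ 3 ≤ n by omega) with h2 | h3
  · right; left
    intro i h1 h2 h3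
    omega
  have key : ∀ i j : Fin (n + 1), q 1 i j = ((qr q 1 i j : ℝ) : ℂ) := by
    intro i j
    have h := qr_fin q 1 i j
    have h1 : ((1 : Fin (n + 1)) : ℕ) = 1 := by
      rw [Fin.val_one', Nat.mod_eq_of_lt (by omega)]
    rw [h1] at h
    rw [h, qreal]
  have hval : ∀ k, k ≤ n → (((k : ℕ) : Fin (n + 1)) : ℕ) = k := by
    intro k hk
    rw [Fin.val_natCast, Nat.mod_eq_of_lt (by omega)]
  rcases main_real S hsym q hcom himp h3 with h | h
  · left
    intro i hi
    have : (i : ℕ) ≠ 0 := fun h0 => hi (Fin.ext h0)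
    rw [key, h i (by omega) (by omega)]
    simp
  · right; left
    intro i h1 h2 h3
    rw [key, key, hval _ (by omega), hval _ (by omega), hval _ (by omega), hval _ (by omega),
      h i h1 h2 h3]


end AssocScheme
end

section
/- Let (X, R) be a symmetric association scheme with n classes that is metric with respect to the ordering A_0, …, A_n, and let Y ⊆ X with 1 < |Y| < |X|, with minimum distance δ and dual degree s*. Then δ ≤ 2s* + 1, and Σ_{i=0}^{⌊(δ−1)/2⌋} k_i ≤ |X|/|Y| ≤ Σ_{i=0}^{s*} k_i (the sphere-packing bound and the dual-degree bound). -/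
open Matrix BigOperators
open scoped ComplexOrder
open scoped Fin.NatCast

namespace AssocScheme

section aux
variable {X : Type*} [Fintype X] [DecidableEq X] {n : ℕ}

theorem exUnique_rel (S : Scheme X n) (x y : X) :
    ∃ i, ∀ j, S.A j x y = if j = i then 1 else 0 := by
  classical
  have h := congrFun (congrFun S.A_sum x) y
  rw [Matrix.sum_apply] at h
  have h2 : ∀ i, S.A i x y = if S.A i x y = 1 then 1 else 0 := by
    intro i
    rcases S.A_zeroOne i x y with h | h <;> simp [h]
  rw [Finset.sum_congr rfl (fun i _ => h2 i), Finset.sum_boole] at h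
  simp only [Matrix.of_apply] at h
  have h3 : (Finset.univ.filter fun i => S.A i x y = 1).card = 1 := by exact_mod_cast h
  obtain ⟨i, hi⟩ := Finset.card_eq_one.mp h3
  refine ⟨i, fun j => ?_⟩
  rw [h2 j]
  have : S.A j x y = 1 ↔ j = i := by
    have := congrArg (fun s => j ∈ s) hi
    simpa using this
  simp [this]

/-- The distance (index of the relation) of two points. -/
noncomputable def dst (S : Scheme X n) (x y : X) : Fin (n + 1) := (exUnique_rel S x y).choose

theorem A_apply (S : Scheme X n) (x y : X) (j : Fin (n + 1)) :
    S.A j x y = if j = dst S x y then 1 else 0 := (exUnique_rel S x y).choose_spec j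

theorem dst_eq_iff (S : Scheme X n) (x y : X) (j : Fin (n + 1)) :
    dst S x y = j ↔ S.A j x y ≠ 0 := by
  rw [A_apply]; simp [eq_comm]

theorem dst_comm (S : Scheme X n) (hs : S.IsSym) (x y : X) : dst S x y = dst S y x := by
  rw [dst_eq_iff, ← hs, Matrix.transpose_apply, ← dst_eq_iff]

theorem dst_eq_zero (S : Scheme X n) (x y : X) : dst S x y = 0 ↔ x = y := by
  rw [dst_eq_iff, S.A_zero, Matrix.one_apply]; simp

theorem p_eq (S : Scheme X n) (x y : X) (i j : Fin (n + 1)) :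
    S.p i j (dst S x y) = ∑ z, S.A i x z * S.A j z y := by
  have h := congrFun (congrFun (S.A_mul i j) x) y
  rw [Matrix.mul_apply, Matrix.sum_apply] at h
  rw [h]
  simp [A_apply]

theorem dst_triangle (S : Scheme X n) (hm : S.Metric) (x y z : X) :
    (dst S x z : ℕ) ≤ dst S x y + dst S y z := by
  by_contra! hlt
  have h0 := (hm _ _ _).1 hlt
  rw [p_eq] at h0
  simp only [A_apply, ← ite_and, ite_mul, one_mul, zero_mul] at h0
  rw [Finset.sum_boole] at h0
  have h1 : (Finset.univ.filter fun w => dst S x y = dst S x w ∧ dst S y z = dst S w z).card = 0 := by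
    exact_mod_cast h0
  rw [Finset.card_eq_zero] at h1
  have : y ∈ (Finset.univ.filter fun w => dst S x y = dst S x w ∧ dst S y z = dst S w z) := by simp
  rw [h1] at this
  simp at this

theorem dst_between (S : Scheme X n) (hm : S.Metric) (x y : X) (i j : Fin (n + 1))
    (h : (dst S x y : ℕ) = i + j) : ∃ z, dst S x z = i ∧ dst S z y = j := by
  have h0 := (hm _ _ _).2 h
  rw [p_eq] at h0
  obtain ⟨z, -, hz⟩ := Finset.exists_ne_zero_of_sum_ne_zero h0
  exact ⟨z, (dst_eq_iff ..).2 (left_ne_zero_of_mul hz), (dst_eq_iff ..).2 (right_ne_zero_of_mul hz)⟩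

theorem A_mul_E (S : Scheme X n) {P : Matrix (Fin (n + 1)) (Fin (n + 1)) ℂ} (hP : S.IsP P)
    (i j : Fin (n + 1)) : S.A i * S.E j = P j i • S.E j := by
  rw [hP i, Finset.sum_mul]
  simp [S.E_mul]

theorem card_sphere [Nonempty X] (S : Scheme X n) {P : Matrix (Fin (n + 1)) (Fin (n + 1)) ℂ}
    (hP : S.IsP P) (i : Fin (n + 1)) (x : X) :
    P 0 i = ((Finset.univ.filter fun y => dst S x y = i).card : ℂ) := by
  have h := congrFun (congrFun (A_mul_E S hP i 0) x) x
  rw [S.E_zero, Matrix.mul_apply] at h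
  have hX : (Fintype.card X : ℂ) ≠ 0 := by exact_mod_cast Fintype.card_ne_zero
  simp only [Matrix.smul_apply, Matrix.of_apply, smul_eq_mul, mul_one] at h
  rw [← Finset.sum_mul] at h
  have h2 := mul_right_cancel₀ (inv_ne_zero hX) h
  rw [← h2, ← Finset.sum_boole]
  refine Finset.sum_congr rfl fun y _ => ?_
  rw [A_apply]
  simp [eq_comm]

theorem card_ball [Nonempty X] (S : Scheme X n) {P : Matrix (Fin (n + 1)) (Fin (n + 1)) ℂ}
    (hP : S.IsP P) (m : ℕ) (hm : m ≤ n) (x : X) :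
    ∑ i ∈ Finset.range (m + 1), P 0 ((i : ℕ) : Fin (n + 1)) =
      ((Finset.univ.filter fun y => (dst S x y : ℕ) ≤ m).card : ℂ) := by
  rw [Finset.card_eq_sum_card_fiberwise (f := fun y => (dst S x y : ℕ))
    (t := Finset.range (m + 1))]
  · push_cast
    refine Finset.sum_congr rfl fun i hi => ?_
    rw [card_sphere S hP _ x]
    congr 2
    ext y
    have hi' : i < n + 1 := by have := Finset.mem_range.mp hi; omega
    have := Finset.mem_range.mp hi
    simp only [Finset.mem_filter, Finset.mem_univ, true_and, Fin.ext_iff, Fin.val_natCast,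
      Nat.mod_eq_of_lt hi']
    omega
  · intro y hy
    simp at hy ⊢
    omega

theorem theta_ne (S : Scheme X n) (hn : 1 ≤ n) (hm : S.Metric)
    {P : Matrix (Fin (n + 1)) (Fin (n + 1)) ℂ} (hP : S.IsP P) (j : Fin (n + 1)) (hj : j ≠ 0) :
    P 0 1 ≠ P j 1 := by
  intro he
  have h1v : ((1 : Fin (n + 1)) : ℕ) = 1 := by
    rw [Fin.val_one']; exact Nat.mod_eq_of_lt (by omega)
  let W : Submodule ℂ (Matrix X X ℂ) :=
    { carrier := {M | ∃ c : ℂ, M * S.E 0 = c • S.E 0 ∧ M * S.E j = c • S.E j}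
      add_mem' := by
        rintro a b ⟨c, h1, h2⟩ ⟨d, h3, h4⟩
        exact ⟨c + d, by rw [add_mul, h1, h3, add_smul], by rw [add_mul, h2, h4, add_smul]⟩
      zero_mem' := ⟨0, by simp, by simp⟩
      smul_mem' := by
        rintro a M ⟨c, h1, h2⟩
        exact ⟨a * c, by rw [smul_mul_assoc, h1, smul_smul], by rw [smul_mul_assoc, h2, smul_smul]⟩ }
  have hmul : ∀ M ∈ W, ∀ N ∈ W, M * N ∈ W := by
    rintro M ⟨c, h1, h2⟩ N ⟨d, h3, h4⟩
    exact ⟨d * c, by rw [mul_assoc, h3, mul_smul_comm, h1, smul_smul],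
      by rw [mul_assoc, h4, mul_smul_comm, h2, smul_smul]⟩
  have hA1 : S.A 1 ∈ W := ⟨P 0 1, A_mul_E S hP _ _, by rw [he]; exact A_mul_E S hP _ _⟩
  have hA : ∀ m : ℕ, ∀ i : Fin (n + 1), (i : ℕ) = m → S.A i ∈ W := by
    intro m
    induction m using Nat.strong_induction_on with
    | _ m ih =>
      intro i hi
      rcases m with _ | m
      · have : i = 0 := Fin.ext hi
        rw [this, S.A_zero]
        exact ⟨1, by simp, by simp⟩
      · have hmn : m < n + 1 := by have := i.2; omega
        have hprod := S.A_mul 1 ⟨m, hmn⟩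
        rw [← Finset.add_sum_erase _ _ (Finset.mem_univ i)] at hprod
        have hp : S.p 1 ⟨m, hmn⟩ i ≠ 0 := (hm _ _ _).2 (by simp only [h1v]; omega)
        have hmem : S.p 1 ⟨m, hmn⟩ i • S.A i ∈ W := by
          rw [← sub_eq_iff_eq_add] at hprod
          rw [← hprod]
          refine W.sub_mem (hmul _ hA1 _ (ih m (by omega) _ rfl)) (W.sum_mem fun k hk => ?_)
          have hki : (k : ℕ) ≠ i := fun h => (Finset.ne_of_mem_erase hk) (Fin.ext h)
          by_cases hlt : 1 + m < (k : ℕ)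
          · rw [(hm 1 ⟨m, hmn⟩ k).1 (by simp only [h1v]; omega), zero_smul]
            exact W.zero_mem
          · exact W.smul_mem _ (ih k (by omega) k rfl)
        have := W.smul_mem (S.p 1 ⟨m, hmn⟩ i)⁻¹ hmem
        rwa [inv_smul_smul₀ hp] at this
  have hE : S.E 0 ∈ W := by
    have : Submodule.span ℂ (Set.range S.A) ≤ W := by
      rw [Submodule.span_le]
      rintro _ ⟨i, rfl⟩
      exact hA _ i rfl
    exact this (S.E_span 0)
  obtain ⟨c, h1, h2⟩ := hE
  rw [S.E_mul, if_pos rfl] at h1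
  rw [S.E_mul, if_neg hj.symm] at h2
  have hc : c = 0 := (smul_eq_zero.mp h2.symm).resolve_right (S.E_ne j)
  rw [hc, zero_smul] at h1
  exact S.E_ne 0 h1

theorem exists_poly (S : Scheme X n) (hn : 1 ≤ n) (hm : S.Metric)
    {P : Matrix (Fin (n + 1)) (Fin (n + 1)) ℂ} (hP : S.IsP P) (T : Finset (Fin (n + 1))) :
    0 ∉ T → ∃ M : Matrix X X ℂ, (∀ x y, M x y ≠ 0 → (dst S x y : ℕ) ≤ T.card) ∧
      (∀ i, ∃ c : ℂ, M * S.E i = c • S.E i ∧ (i ∈ T → c = 0) ∧ (i = 0 → c ≠ 0)) := by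
  have h1v : ((1 : Fin (n + 1)) : ℕ) = 1 := by
    rw [Fin.val_one']; exact Nat.mod_eq_of_lt (by omega)
  induction T using Finset.induction_on with
  | empty =>
    intro _
    refine ⟨1, fun x y h => ?_, fun i => ⟨1, by simp, by simp, by simp⟩⟩
    rw [← S.A_zero, ← dst_eq_iff] at h
    simp [h]
  | insert j T hj ih =>
    intro h0
    simp only [Finset.mem_insert, not_or] at h0
    obtain ⟨M, hM, hE⟩ := ih h0.2
    refine ⟨M * (S.A 1 - P j 1 • 1), fun x y h => ?_, fun i => ?_⟩
    · rw [Finset.card_insert_of_notMem hj]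
      rw [mul_sub, Matrix.mul_smul, mul_one, Matrix.sub_apply, Matrix.smul_apply, Matrix.mul_apply] at h
      by_cases hxy : M x y = 0
      · rw [hxy, smul_zero, sub_zero] at h
        obtain ⟨z, -, hz⟩ := Finset.exists_ne_zero_of_sum_ne_zero h
        have h1 := hM _ _ (left_ne_zero_of_mul hz)
        have h2 := (dst_eq_iff ..).2 (right_ne_zero_of_mul hz)
        have h3 := dst_triangle S hm x z y
        rw [h2, h1v] at h3
        omega
      · have := hM _ _ hxy
        omega
    · obtain ⟨c, h1, h2, h3⟩ := hE i
      refine ⟨(P i 1 - P j 1) * c, ?_, ?_, ?_⟩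
      · rw [mul_assoc, sub_mul, A_mul_E S hP, smul_mul_assoc, one_mul, ← sub_smul, mul_smul_comm,
          h1, smul_smul]
      · intro hi
        rcases Finset.mem_insert.mp hi with rfl | hi
        · simp
        · simp [h2 hi]
      · rintro rfl
        exact mul_ne_zero (sub_ne_zero.2 (theta_ne S hn hm hP j (Ne.symm h0.1))) (h3 rfl)

/-- characteristic vector -/
noncomputable def chr (Y : Finset X) : X → ℂ := fun x => if x ∈ Y then 1 else 0

theorem mulVec_chr (M : Matrix X X ℂ) (Y : Finset X) (x : X) :
    (M *ᵥ chr Y) x = ∑ y ∈ Y, M x y := by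
  simp [Matrix.mulVec, dotProduct, chr]

theorem E_chr [Nonempty X] (S : Scheme X n) {Q : Matrix (Fin (n + 1)) (Fin (n + 1)) ℂ}
    (hQ : S.IsQ Q) (Y : Finset X) (hY : Y.card ≠ 0) (i : Fin (n + 1))
    (h : macT Q (innerDist S Y) i = 0) : S.E i *ᵥ chr Y = 0 := by
  have hX : (Fintype.card X : ℂ) ≠ 0 := by exact_mod_cast Fintype.card_ne_zero
  have hY' : (Y.card : ℂ) ≠ 0 := by exact_mod_cast hY
  have h1 : ∑ x ∈ Y, ∑ y ∈ Y, S.E i x y = 0 := by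
    have : ∑ x ∈ Y, ∑ y ∈ Y, S.E i x y =
        (Fintype.card X : ℂ)⁻¹ * (Y.card * macT Q (innerDist S Y) i) := by
      rw [hQ i]
      simp only [Matrix.smul_apply, Matrix.sum_apply, smul_eq_mul, ← Finset.mul_sum]
      congr 1
      simp only [macT, innerDist]
      rw [Finset.mul_sum]
      simp_rw [Finset.sum_comm (s := Y) (t := Finset.univ)]
      refine Finset.sum_congr rfl fun j _ => ?_
      simp only [← Finset.mul_sum]
      field_simp
    rw [this, h]; simp
  have h2 : star (S.E i *ᵥ chr Y) ⬝ᵥ (S.E i *ᵥ chr Y) = 0 := by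
    rw [Matrix.star_mulVec, (S.E_herm i).eq, ← Matrix.dotProduct_mulVec, Matrix.mulVec_mulVec,
      S.E_mul, if_pos rfl, ← h1]
    simp only [dotProduct, mulVec_chr]
    simp [chr, apply_ite]
  exact dotProduct_star_self_eq_zero.mp h2

theorem covering [Nonempty X] (S : Scheme X n) (hn : 1 ≤ n) (hm : S.Metric)
    {P Q : Matrix (Fin (n + 1)) (Fin (n + 1)) ℂ} (hP : S.IsP P) (hQ : S.IsQ Q)
    (Y : Finset X) (hY : Y.card ≠ 0) (T : Finset (Fin (n + 1))) (h0 : 0 ∉ T)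
    (hT : ∀ i, i ≠ 0 → i ∉ T → macT Q (innerDist S Y) i = 0) (x : X) :
    ∃ y ∈ Y, (dst S x y : ℕ) ≤ T.card := by
  have hX : (Fintype.card X : ℂ) ≠ 0 := by exact_mod_cast Fintype.card_ne_zero
  have hY' : (Y.card : ℂ) ≠ 0 := by exact_mod_cast hY
  obtain ⟨M, hM, hE⟩ := exists_poly S hn hm hP T h0
  obtain ⟨c, hc1, -, hc3⟩ := hE 0
  have key : M *ᵥ chr Y = c • (S.E 0 *ᵥ chr Y) := by
    calc M *ᵥ chr Y = (M * ∑ i, S.E i) *ᵥ chr Y := by rw [S.E_sum, mul_one]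
      _ = ∑ i, (M * S.E i) *ᵥ chr Y := by rw [Finset.mul_sum, Matrix.sum_mulVec]
      _ = (M * S.E 0) *ᵥ chr Y := by
        refine Finset.sum_eq_single 0 (fun i _ hi => ?_) (by simp)
        obtain ⟨d, hd1, hd2, -⟩ := hE i
        rw [hd1, Matrix.smul_mulVec]
        by_cases hiT : i ∈ T
        · rw [hd2 hiT, zero_smul]
        · rw [E_chr S hQ Y hY i (hT i hi hiT), smul_zero]
      _ = _ := by rw [hc1, Matrix.smul_mulVec]
  have hx := congrFun key x
  rw [Pi.smul_apply, mulVec_chr, mulVec_chr, S.E_zero] at hx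
  have hne : ∑ y ∈ Y, M x y ≠ 0 := by
    rw [hx]
    simp [hX, hc3 rfl, hY']
  obtain ⟨y, hy, hne⟩ := Finset.exists_ne_zero_of_sum_ne_zero hne
  exact ⟨y, hy, hM _ _ hne⟩

end aux

/-- in a metric scheme, `δ ≤ 2s* + 1` and the sphere-packing/dual-degree
bounds `∑_{i ≤ ⌊(δ-1)/2⌋} k_i ≤ |X|/|Y| ≤ ∑_{i ≤ s*} k_i` hold (inequalities in the
complex order, `k_i = P 0 i`). -/
theorem sphere_packing_and_dual_degree_bound {X : Type*} [Fintype X] [DecidableEq X]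
    [Nonempty X] {n : ℕ} (hn : 1 ≤ n) (S : Scheme X n) (hsym : S.IsSym) (hmet : S.Metric)
    (P Q : Matrix (Fin (n + 1)) (Fin (n + 1)) ℂ) (hP : S.IsP P) (hQ : S.IsQ Q)
    (Y : Finset X) (hY1 : 1 < Y.card) (hY2 : Y.card < Fintype.card X)
    (δ : Fin (n + 1))
    (hδ : IsLeast {i : Fin (n + 1) | i ≠ 0 ∧ innerDist S Y i ≠ 0} δ) :
    (δ : ℕ) ≤ 2 * Nat.card {i : Fin (n + 1) | i ≠ 0 ∧ macT Q (innerDist S Y) i ≠ 0} + 1 ∧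
      (∑ i ∈ Finset.range (((δ : ℕ) - 1) / 2 + 1), P 0 ((i : ℕ) : Fin (n + 1))) ≤
        (Fintype.card X : ℂ) / (Y.card : ℂ) ∧
      (Fintype.card X : ℂ) / (Y.card : ℂ) ≤
        ∑ i ∈ Finset.range
          (Nat.card {i : Fin (n + 1) | i ≠ 0 ∧ macT Q (innerDist S Y) i ≠ 0} + 1),
          P 0 ((i : ℕ) : Fin (n + 1)) := by
  classical
  set T : Finset (Fin (n + 1)) :=
    Finset.univ.filter fun i => i ≠ 0 ∧ macT Q (innerDist S Y) i ≠ 0 with hT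
  have hcard : Nat.card {i : Fin (n + 1) | i ≠ 0 ∧ macT Q (innerDist S Y) i ≠ 0} = T.card := by
    rw [Nat.card_coe_set_eq, ← Set.ncard_coe_finset]
    congr 1
    ext i
    simp [hT]
  rw [hcard]
  have h0 : (0 : Fin (n + 1)) ∉ T := by simp [hT]
  have hTn : T.card ≤ n := by
    have h1 : T.card ≤ (Finset.univ.erase (0 : Fin (n + 1))).card :=
      Finset.card_le_card fun i hi => Finset.mem_erase.2
        ⟨fun h => h0 (h ▸ hi), Finset.mem_univ _⟩
    simpa using h1
  have hY : Y.card ≠ 0 := by omega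
  have hYpos : (0 : ℂ) < (Y.card : ℂ) := by exact_mod_cast Nat.pos_of_ne_zero hY
  have hcov := covering S hn hmet hP hQ Y hY T h0 (by
    intro i hi hiT
    by_contra hne
    exact hiT (by simp [hT, hi, hne]))
  -- minimum distance in terms of the distance function
  have hmin : ∀ x ∈ Y, ∀ y ∈ Y, x ≠ y → (δ : ℕ) ≤ dst S x y := by
    intro x hx y hy hxy
    have hmem : dst S x y ∈ {i : Fin (n + 1) | i ≠ 0 ∧ innerDist S Y i ≠ 0} := by
      refine ⟨fun h => hxy ((dst_eq_zero S x y).1 h), ?_⟩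
      refine mul_ne_zero (inv_ne_zero hYpos.ne') ?_
      have hnn : ∀ a b, 0 ≤ S.A (dst S x y) a b := by
        intro a b
        rw [A_apply]
        split_ifs <;> simp
      have h1 : (1 : ℂ) ≤ ∑ a ∈ Y, ∑ b ∈ Y, S.A (dst S x y) a b := by
        calc (1 : ℂ) = S.A (dst S x y) x y := by rw [A_apply, if_pos rfl]
          _ ≤ ∑ b ∈ Y, S.A (dst S x y) x b :=
            Finset.single_le_sum (f := fun b => S.A (dst S x y) x b) (fun b _ => hnn x b) hy
          _ ≤ _ := Finset.single_le_sum (f := fun a => ∑ b ∈ Y, S.A (dst S x y) a b)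
            (fun a _ => Finset.sum_nonneg fun b _ => hnn a b) hx
      exact (lt_of_lt_of_le zero_lt_one h1).ne'
    exact hδ.2 hmem
  have hδ0 : 1 ≤ (δ : ℕ) := by
    have := hδ.1.1
    rw [Ne, Fin.ext_iff, Fin.val_zero] at this
    omega
  have hatt : ∃ x ∈ Y, ∃ y ∈ Y, dst S x y = δ := by
    have h1 := right_ne_zero_of_mul hδ.1.2
    obtain ⟨x, hx, h2⟩ := Finset.exists_ne_zero_of_sum_ne_zero h1
    obtain ⟨y, hy, h3⟩ := Finset.exists_ne_zero_of_sum_ne_zero h2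
    exact ⟨x, hx, y, hy, (dst_eq_iff ..).2 h3⟩
  refine ⟨?_, ?_, ?_⟩
  · by_contra! hlt
    obtain ⟨x, hx, y, hy, hxy⟩ := hatt
    have hδn := δ.2
    obtain ⟨z, hz1, hz2⟩ := dst_between S hmet x y ⟨T.card + 1, by omega⟩
      ⟨(δ : ℕ) - (T.card + 1), by omega⟩ (by simp only [hxy]; omega)
    obtain ⟨w, hw, hzw⟩ := hcov z
    have hz1' : (dst S x z : ℕ) = T.card + 1 := by rw [hz1]
    have hne : x ≠ w := by
      rintro rfl
      rw [dst_comm S hsym] at hzw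
      omega
    have h1 := hmin x hx w hw hne
    have h2 := dst_triangle S hmet x z w
    omega
  · obtain ⟨x₀⟩ := ‹Nonempty X›
    have hδn := δ.2
    have : Nonempty X := ⟨x₀⟩
    rw [le_div_iff₀ hYpos]
    have hb := card_ball S hP (((δ : ℕ) - 1) / 2) (by omega)
    rw [mul_comm, ← nsmul_eq_mul, ← Finset.sum_const, Finset.sum_congr rfl (fun y _ => hb y)]
    have : ∑ y ∈ Y, (Finset.univ.filter fun z => (dst S y z : ℕ) ≤ ((δ : ℕ) - 1) / 2).card
        ≤ Fintype.card X := by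
      rw [← Finset.card_biUnion]
      · exact Finset.card_le_univ _
      · intro x hx y hy hxy
        refine Finset.disjoint_left.2 ?_
        intro z hz1 hz2
        simp only [Finset.mem_filter, Finset.mem_univ, true_and] at hz1 hz2
        rw [dst_comm S hsym] at hz2
        have h1 := hmin x hx y hy hxy
        have h2 := dst_triangle S hmet x z y
        omega
    exact_mod_cast this
  · rw [div_le_iff₀ hYpos]
    have hb := card_ball S hP T.card hTn
    rw [mul_comm, ← nsmul_eq_mul, ← Finset.sum_const, Finset.sum_congr rfl (fun y _ => hb y)]
    have : Fintype.card X ≤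
        ∑ y ∈ Y, (Finset.univ.filter fun z => (dst S y z : ℕ) ≤ T.card).card := by
      refine le_trans ?_ Finset.card_biUnion_le
      rw [← Finset.card_univ]
      refine Finset.card_le_card fun z _ => ?_
      obtain ⟨y, hy, hzy⟩ := hcov z
      rw [dst_comm S hsym] at hzy
      simp only [Finset.mem_biUnion, Finset.mem_filter, Finset.mem_univ, true_and]
      exact ⟨y, hy, hzy⟩
    exact_mod_cast this

end AssocScheme
end

section
/- Let (X, R) be a symmetric association scheme with n classes that is cometric with respect to the ordering E_0, …, E_n, and let Y ⊆ X with 1 < |Y| < |X|, with dual distance δ* and degree s. Then δ* ≤ 2s + 1, and Σ_{i=0}^{⌊(δ*−1)/2⌋} m_i ≤ |Y| ≤ Σ_{i=0}^{s} m_i (the Fisher-type inequality and the degree bound). -/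
open Matrix BigOperators
open scoped ComplexOrder
open scoped Fin.NatCast

namespace AssocScheme
section core
set_option linter.unusedSectionVars false
variable {X : Type*} [Fintype X] [DecidableEq X] {n : ℕ}

/-- span of the first `k+1` idempotents -/
def WW (E : Fin (n + 1) → Matrix X X ℝ) (k : ℕ) : Submodule ℝ (Matrix X X ℝ) :=
  Submodule.span ℝ (E '' {i | (i : ℕ) ≤ k})

/-- sum of the first `k+1` idempotents -/
def MM (E : Fin (n + 1) → Matrix X X ℝ) (k : ℕ) : Matrix X X ℝ :=
  ∑ i ∈ Finset.univ.filter (fun i : Fin (n + 1) => (i : ℕ) ≤ k), E i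

/-- real data extracted from a cometric scheme -/
structure Core_s8 (E : Fin (n + 1) → Matrix X X ℝ)
    (q : Fin (n + 1) → Fin (n + 1) → Fin (n + 1) → ℝ) (d : Fin (n + 1) → ℝ) : Prop where
  hn : 1 ≤ n
  ne : Nonempty X
  E_zero : ∀ x y, E 0 x y = (Fintype.card X : ℝ)⁻¹
  E_ne : ∀ i, E i ≠ 0
  E_symm : ∀ i x y, E i x y = E i y x
  E_mul : ∀ i j, E i * E j = if i = j then E i else 0
  E_sum : ∑ i, E i = 1
  E_diag : ∀ i x, E i x x = d i
  krein : ∀ i j x y, E i x y * E j x y = ∑ k, q i j k * E k x y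
  q_zero : ∀ i j k : Fin (n + 1), (i : ℕ) + (j : ℕ) < (k : ℕ) → q i j k = 0
  q_ne : ∀ i j k : Fin (n + 1), (k : ℕ) = (i : ℕ) + (j : ℕ) → q i j k ≠ 0

variable {E : Fin (n + 1) → Matrix X X ℝ}
    {q : Fin (n + 1) → Fin (n + 1) → Fin (n + 1) → ℝ} {d : Fin (n + 1) → ℝ}

lemma WW_mono {k l : ℕ} (h : k ≤ l) : WW E k ≤ WW E l :=
  Submodule.span_mono (Set.image_mono fun _ hi => le_trans hi h)

lemma E_mem_WW {i : Fin (n + 1)} {k : ℕ} (h : (i : ℕ) ≤ k) : E i ∈ WW E k :=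
  Submodule.subset_span ⟨i, h, rfl⟩

lemma Core_s8.one_val (C : Core_s8 E q d) : ((1 : Fin (n + 1)) : ℕ) = 1 := by
  have := C.hn
  obtain ⟨m, rfl⟩ : ∃ m, n = m + 1 := ⟨n - 1, by omega⟩
  simp

lemma Core_s8.had (C : Core_s8 E q d) {i j : Fin (n + 1)} {k : ℕ} (h : (i : ℕ) + j ≤ k) :
    (Matrix.of fun x y => E i x y * E j x y) ∈ WW E k := by
  have : (Matrix.of fun x y => E i x y * E j x y) = ∑ l, q i j l • E l := by
    ext x y
    simp [C.krein i j x y, Matrix.sum_apply]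
  rw [this]
  refine Submodule.sum_mem _ fun l _ => ?_
  by_cases hl : (l : ℕ) ≤ k
  · exact Submodule.smul_mem _ _ (E_mem_WW hl)
  · rw [C.q_zero i j l (by omega)]
    simp

lemma Core_s8.had_mem (C : Core_s8 E q d) {k : ℕ} {G : Matrix X X ℝ} (hG : G ∈ WW E k) :
    (Matrix.of fun x y => E 1 x y * G x y) ∈ WW E (k + 1) := by
  induction hG using Submodule.span_induction with
  | mem G h =>
    obtain ⟨i, hi, rfl⟩ := h
    apply C.had
    rw [C.one_val]
    have : (i : ℕ) ≤ k := hi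
    omega
  | zero =>
    convert Submodule.zero_mem (WW E (k+1))
    ext; simp
  | add a b _ _ ha hb =>
    convert Submodule.add_mem _ ha hb
    ext; simp [mul_add]
  | smul c a _ ha =>
    convert Submodule.smul_mem _ c ha
    ext; simp; ring

lemma Core_s8.pow_mem (C : Core_s8 E q d) (k : ℕ) :
    (Matrix.of fun x y => E 1 x y ^ k) ∈ WW E k := by
  have := C.ne
  induction k with
  | zero =>
    have h : (Matrix.of fun x y => E 1 x y ^ 0) = (Fintype.card X : ℝ) • E 0 := by
      ext x y
      simp [C.E_zero]
    rw [h]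
    exact Submodule.smul_mem _ _ (E_mem_WW (by simp))
  | succ k ih =>
    convert C.had_mem ih using 1
    ext x y
    simp [pow_succ']

lemma Core_s8.poly_mem (C : Core_s8 E q d) (p : Polynomial ℝ) {k : ℕ} (hk : p.natDegree ≤ k) :
    (Matrix.of fun x y => p.eval (E 1 x y)) ∈ WW E k := by
  have h : (Matrix.of fun x y => p.eval (E 1 x y)) =
      ∑ i ∈ Finset.range (k + 1), p.coeff i • (Matrix.of fun x y => E 1 x y ^ i) := by
    ext x y
    simp [Matrix.sum_apply, Polynomial.eval_eq_sum_range' (Nat.lt_succ_of_le hk)]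
  rw [h]
  refine Submodule.sum_mem _ fun i hi => Submodule.smul_mem _ _ ?_
  exact WW_mono (by simp at hi; omega) (C.pow_mem i)

lemma Core_s8.MM_mul (C : Core_s8 E q d) {k : ℕ} {G : Matrix X X ℝ} (hG : G ∈ WW E k) :
    MM E k * G = G := by
  induction hG using Submodule.span_induction with
  | mem G h =>
    obtain ⟨i, hi, rfl⟩ := h
    have hi' : (i : ℕ) ≤ k := hi
    simp [MM, Finset.sum_mul, C.E_mul, hi']
  | zero => simp
  | add a b _ _ ha hb => rw [mul_add, ha, hb]
  | smul c a _ ha => rw [mul_smul_comm, ha]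

lemma Core_s8.mul_last (C : Core_s8 E q d) {k : ℕ} {G : Matrix X X ℝ} (hG : G ∈ WW E k)
    (j : Fin (n + 1)) (hj : k < j) : E j * G = 0 := by
  induction hG using Submodule.span_induction with
  | mem G h =>
    obtain ⟨i, hi, rfl⟩ := h
    have hi' : (i : ℕ) ≤ k := hi
    rw [C.E_mul, if_neg]
    rintro rfl
    omega
  | zero => simp
  | add a b _ _ ha hb => rw [mul_add, ha, hb, add_zero]
  | smul c a _ ha => rw [mul_smul_comm, ha, smul_zero]

lemma MM_mem (k : ℕ) : MM E k ∈ WW E k :=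
  Submodule.sum_mem _ fun i hi => E_mem_WW (by simpa using hi)

lemma Core_s8.sum_all (C : Core_s8 E q d) {i : Fin (n + 1)} (hi : i ≠ 0) :
    ∑ x, ∑ y, E i x y = 0 := by
  have := C.ne
  have hv : (Fintype.card X : ℝ) ≠ 0 := by simp
  have h := C.E_mul 0 i
  rw [if_neg (Ne.symm hi)] at h
  refine Finset.sum_comm.trans (Finset.sum_eq_zero fun y _ => ?_)
  have h2 := congrFun (congrFun h (Classical.arbitrary X)) y
  simp only [Matrix.mul_apply, C.E_zero, Matrix.zero_apply, ← Finset.mul_sum] at h2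
  simpa [hv] using h2

lemma Core_s8.avg (C : Core_s8 E q d) {Y : Finset X} {δ k : ℕ}
    (hδ : ∀ i : Fin (n + 1), i ≠ 0 → (i : ℕ) < δ → ∑ x ∈ Y, ∑ y ∈ Y, E i x y = 0)
    (hk : k < δ) {G : Matrix X X ℝ} (hG : G ∈ WW E k) :
    (Fintype.card X : ℝ) ^ 2 * ∑ x ∈ Y, ∑ y ∈ Y, G x y
      = (Y.card : ℝ) ^ 2 * ∑ x, ∑ y, G x y := by
  induction hG using Submodule.span_induction with
  | mem G h =>
    obtain ⟨i, hi, rfl⟩ := h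
    have hi' : (i : ℕ) ≤ k := hi
    by_cases h0 : i = 0
    · subst h0
      simp [C.E_zero]
      ring
    · rw [hδ i h0 (by omega), C.sum_all h0]
      simp
  | zero => simp
  | add a b _ _ ha hb =>
    simp only [Matrix.add_apply, Finset.sum_add_distrib, mul_add, ha, hb]
  | smul c a _ ha =>
    simp only [Matrix.smul_apply, smul_eq_mul, ← Finset.mul_sum]
    linear_combination c * ha

lemma Core_s8.d_pos (C : Core_s8 E q d) (i : Fin (n + 1)) : 0 < d i := by
  have key : ∀ x, d i = ∑ z, E i x z ^ 2 := by
    intro x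
    have h := congrFun (congrFun (C.E_mul i i) x) x
    rw [if_pos rfl, C.E_diag, Matrix.mul_apply] at h
    rw [← h]
    exact Finset.sum_congr rfl fun z _ => by rw [C.E_symm i z x]; ring
  by_contra hd
  apply C.E_ne i
  ext x y
  have h1 : ∑ z, E i x z ^ 2 = 0 :=
    le_antisymm (by rw [← key]; linarith) (Finset.sum_nonneg fun _ _ => sq_nonneg _)
  have := (Finset.sum_eq_zero_iff_of_nonneg (fun _ _ => sq_nonneg _)).1 h1 y (Finset.mem_univ _)
  simpa using this

lemma Core_s8.lt_diag (C : Core_s8 E q d) {x y : X} (hxy : x ≠ y) : E 1 x y < d 1 := by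
  have hle : E 1 x y ≤ d 1 := by
    have h : ∀ a b, ∑ z, E 1 a z * E 1 b z = E 1 a b := by
      intro a b
      have h := congrFun (congrFun (C.E_mul 1 1) a) b
      rw [if_pos rfl, Matrix.mul_apply] at h
      rw [← h]
      exact Finset.sum_congr rfl fun z _ => by rw [C.E_symm 1 z b]
    have h2 : 0 ≤ ∑ z, (E 1 x z - E 1 y z) ^ 2 := Finset.sum_nonneg fun _ _ => sq_nonneg _
    have h3 : ∑ z, (E 1 x z - E 1 y z) ^ 2 = E 1 x x + E 1 y y - 2 * E 1 x y := by
      rw [← h x x, ← h y y, ← h x y, Finset.mul_sum, ← Finset.sum_add_distrib,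
        ← Finset.sum_sub_distrib]
      exact Finset.sum_congr rfl fun z _ => by ring
    rw [h3, C.E_diag, C.E_diag] at h2
    linarith
  refine lt_of_le_of_ne hle fun heq => ?_
  have key : ∀ k : ℕ, ∀ i : Fin (n + 1), (i : ℕ) = k → E i x y = E i x x := by
    intro k
    induction k using Nat.strong_induction_on with
    | _ k ih =>
      intro i hi
      rcases k with _ | k
      · obtain rfl : i = 0 := Fin.ext (by simpa using hi)
        rw [C.E_zero, C.E_zero]
      · have hin := i.isLt
        let j : Fin (n + 1) := ⟨k, by omega⟩
        have hj : (j : ℕ) = k := rfl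
        have h1 := C.krein 1 j x y
        have h2 := C.krein 1 j x x
        rw [heq, ih k (by omega) j hj] at h1
        rw [C.E_diag 1] at h2
        rw [h2] at h1
        have hne := C.q_ne 1 j i (by rw [C.one_val, hi, hj]; omega)
        have hs : ∑ l, q 1 j l * (E l x x - E l x y) = 0 := by
          simp only [mul_sub, Finset.sum_sub_distrib]
          rw [h1, sub_self]
        rw [Finset.sum_eq_single i] at hs
        · rcases mul_eq_zero.1 hs with h | h
          · exact absurd h hne
          · linarith
        · intro l _ hl
          by_cases hlk : (l : ℕ) < k + 1
          · rw [ih l hlk l rfl]; simp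
          · have hl' : (l : ℕ) ≠ i := fun h => hl (Fin.ext h)
            rw [C.q_zero 1 j l (by rw [C.one_val, hj]; omega), zero_mul]
        · simp
  have hs := C.E_sum
  have h1 := congrFun (congrFun hs x) y
  have h2 := congrFun (congrFun hs x) x
  rw [Matrix.sum_apply] at h1 h2
  have h3 : ∑ i, E i x y = ∑ i, E i x x :=
    Finset.sum_congr rfl fun i _ => key (i : ℕ) i rfl
  rw [h1, h2] at h3
  simp [hxy] at h3

lemma Core_s8.MM_idem (C : Core_s8 E q d) (k : ℕ) : MM E k * MM E k = MM E k :=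
  C.MM_mul (MM_mem k)

lemma Core_s8.MM_symm (C : Core_s8 E q d) (k : ℕ) (x y : X) : MM E k x y = MM E k y x := by
  simp only [MM, Matrix.sum_apply]
  exact Finset.sum_congr rfl fun i _ => C.E_symm i x y

/-- scaled partial sums of multiplicities -/
def dd (d : Fin (n + 1) → ℝ) (k : ℕ) : ℝ :=
  ∑ i ∈ Finset.univ.filter (fun i : Fin (n + 1) => (i : ℕ) ≤ k), d i

lemma Core_s8.MM_diag (C : Core_s8 E q d) (k : ℕ) (x : X) : MM E k x x = dd d k := by
  simp only [MM, dd, Matrix.sum_apply]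
  exact Finset.sum_congr rfl fun i _ => C.E_diag i x

lemma Core_s8.dd_pos (C : Core_s8 E q d) (k : ℕ) : 0 < dd d k := by
  refine Finset.sum_pos (fun i _ => C.d_pos i) ⟨0, by simp⟩

lemma Core_s8.MM_sq_mem (C : Core_s8 E q d) (k : ℕ) :
    (Matrix.of fun x y => MM E k x y ^ 2) ∈ WW E (2 * k) := by
  have h : (Matrix.of fun x y => MM E k x y ^ 2) =
      ∑ i ∈ Finset.univ.filter (fun i : Fin (n + 1) => (i : ℕ) ≤ k),
      ∑ j ∈ Finset.univ.filter (fun i : Fin (n + 1) => (i : ℕ) ≤ k),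
        (Matrix.of fun x y => E i x y * E j x y) := by
    ext x y
    simp only [MM, Matrix.sum_apply, Matrix.of_apply, sq, Finset.sum_mul_sum]
  rw [h]
  refine Submodule.sum_mem _ fun i hi => Submodule.sum_mem _ fun j hj => C.had ?_
  simp at hi hj
  omega

lemma Core_s8.fisher (C : Core_s8 E q d) {Y : Finset X} {δ k : ℕ} (hY : 0 < Y.card)
    (hδ : ∀ i : Fin (n + 1), i ≠ 0 → (i : ℕ) < δ → ∑ x ∈ Y, ∑ y ∈ Y, E i x y = 0)
    (hk : 2 * k < δ) : (Fintype.card X : ℝ) * dd d k ≤ Y.card := by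
  have h := C.avg hδ hk (C.MM_sq_mem k)
  simp only [Matrix.of_apply] at h
  have hall : ∑ x, ∑ y, MM E k x y ^ 2 = Fintype.card X * dd d k := by
    have : ∀ x, ∑ y, MM E k x y ^ 2 = dd d k := by
      intro x
      have h := congrFun (congrFun (C.MM_idem k) x) x
      rw [C.MM_diag, Matrix.mul_apply] at h
      rw [← h]
      exact Finset.sum_congr rfl fun z _ => by rw [C.MM_symm k z x]; ring
    simp [this]
  have hge : (Y.card : ℝ) * dd d k ^ 2 ≤ ∑ x ∈ Y, ∑ y ∈ Y, MM E k x y ^ 2 := by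
    rw [← nsmul_eq_mul]
    refine Finset.card_nsmul_le_sum _ _ _ fun x hx => ?_
    rw [← C.MM_diag k x]
    exact Finset.single_le_sum (f := fun y => MM E k x y ^ 2) (fun _ _ => sq_nonneg _) hx
  rw [hall] at h
  have := C.ne
  have hv : (0 : ℝ) < Fintype.card X := by exact_mod_cast Fintype.card_pos
  have hYp : (0 : ℝ) < Y.card := by exact_mod_cast hY
  have hd := C.dd_pos k
  have h2 : (Fintype.card X : ℝ) ^ 2 * ((Y.card : ℝ) * dd d k ^ 2) ≤
      (Y.card : ℝ) ^ 2 * (Fintype.card X * dd d k) := by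
    rw [← h]; gcongr
  have h3 : 0 < (Fintype.card X : ℝ) * Y.card * dd d k := by positivity
  refine le_of_mul_le_mul_left ?_ h3
  nlinarith

/-- annihilator polynomial -/
noncomputable def annih (E : Fin (n + 1) → Matrix X X ℝ) (Y : Finset X) : Polynomial ℝ :=
  ∏ t ∈ Y.offDiag.image (fun z => E 1 z.1 z.2), (Polynomial.X - Polynomial.C t)

lemma annih_deg (Y : Finset X) :
    (annih E Y).natDegree = (Y.offDiag.image (fun z => E 1 z.1 z.2)).card := by
  simp [annih]

lemma annih_zero {Y : Finset X} {x y : X} (hx : x ∈ Y) (hy : y ∈ Y) (hxy : x ≠ y) :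
    (annih E Y).eval (E 1 x y) = 0 := by
  rw [annih, Polynomial.eval_prod]
  apply Finset.prod_eq_zero (i := E 1 x y)
  · exact Finset.mem_image.2 ⟨(x, y), by simp [hx, hy, hxy], rfl⟩
  · simp

lemma Core_s8.annih_ne (C : Core_s8 E q d) (Y : Finset X) : (annih E Y).eval (d 1) ≠ 0 := by
  rw [annih, Polynomial.eval_prod, Finset.prod_ne_zero_iff]
  intro t ht
  obtain ⟨⟨x, y⟩, hz, rfl⟩ := Finset.mem_image.1 ht
  simp at hz
  have := C.lt_diag hz.2.2
  simp
  intro h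
  linarith

lemma rank_idem (M : Matrix X X ℝ) (h : M * M = M) : (M.rank : ℝ) = M.trace := by
  have hp : LinearMap.IsProj (LinearMap.range M.mulVecLin) M.mulVecLin := by
    refine ⟨fun x => ⟨x, rfl⟩, ?_⟩
    rintro _ ⟨x, rfl⟩
    simp [Matrix.mulVec_mulVec, h]
  have h1 := hp.trace
  rw [Matrix.rank, ← h1]
  exact Matrix.trace_toLin'_eq M

lemma Core_s8.degree (C : Core_s8 E q d) {Y : Finset X} {s : ℕ}
    (hs : (Y.offDiag.image (fun z => E 1 z.1 z.2)).card ≤ s) :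
    (Y.card : ℝ) ≤ (Fintype.card X : ℝ) * dd d s := by
  set G : Matrix X X ℝ := Matrix.of fun x y => (annih E Y).eval (E 1 x y) with hGdef
  have hG : G ∈ WW E s := C.poly_mem _ (by rw [annih_deg]; exact hs)
  have h1 : G.submatrix (Subtype.val : Y → X) (Subtype.val : Y → X) =
      (annih E Y).eval (d 1) • (1 : Matrix Y Y ℝ) := by
    ext x y
    by_cases hxy : x = y
    · subst hxy
      simp [hGdef, C.E_diag]
    · simp [hGdef, hxy, annih_zero x.2 y.2 (fun h => hxy (Subtype.ext h))]
  have h2 : (G.submatrix (Subtype.val : Y → X) (Subtype.val : Y → X)).rank = Y.card := by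
    rw [h1, Matrix.rank_of_isUnit]
    · simp
    · rw [Matrix.isUnit_iff_isUnit_det, Matrix.det_smul, Matrix.det_one, mul_one]
      exact (IsUnit.mk0 _ (C.annih_ne Y)).pow _
  have h3 : Y.card ≤ G.rank := h2 ▸ Matrix.rank_submatrix_le _ _ _
  have h4 : G.rank ≤ (MM E s).rank := by
    rw [← C.MM_mul hG]
    exact Matrix.rank_mul_le_left _ _
  have h5 := rank_idem _ (C.MM_idem s)
  have h6 : (MM E s).trace = (Fintype.card X : ℝ) * dd d s := by
    simp [Matrix.trace, C.MM_diag]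
  rw [← h6, ← h5]
  exact_mod_cast h3.trans h4

lemma Core_s8.dual (C : Core_s8 E q d) {Y : Finset X} {s δ : ℕ} (hY : 0 < Y.card)
    (hs : (Y.offDiag.image (fun z => E 1 z.1 z.2)).card ≤ s)
    (hδ : ∀ i : Fin (n + 1), i ≠ 0 → (i : ℕ) < δ → ∑ x ∈ Y, ∑ y ∈ Y, E i x y = 0)
    (hδn : δ ≤ n) : δ ≤ 2 * s + 1 := by
  by_contra hlt
  set p := annih E Y with hp
  have hpd : p.natDegree ≤ s := by rw [hp, annih_deg]; exact hs
  set H : Polynomial ℝ := (Polynomial.C (d 1) - Polynomial.X) * p ^ 2 with hH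
  have hHd : H.natDegree ≤ 2 * s + 1 := by
    refine Polynomial.natDegree_mul_le.trans ?_
    have a1 : (Polynomial.C (d 1) - Polynomial.X : Polynomial ℝ).natDegree ≤ 1 := by
      compute_degree
    have a2 : (p ^ 2).natDegree ≤ 2 * s :=
      Polynomial.natDegree_pow_le.trans (by omega)
    omega
  have h := C.avg hδ (k := 2 * s + 1) (by omega) (C.poly_mem H hHd)
  simp only [Matrix.of_apply] at h
  have hev : ∀ x y, H.eval (E 1 x y) = (d 1 - E 1 x y) * (p.eval (E 1 x y)) ^ 2 := by
    intro x y; simp [hH]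
  have hnn : ∀ x y, 0 ≤ H.eval (E 1 x y) := by
    intro x y
    rw [hev]
    refine mul_nonneg ?_ (sq_nonneg _)
    by_cases hxy : x = y
    · subst hxy; rw [C.E_diag]; simp
    · have := C.lt_diag hxy; linarith
  have hY0 : ∑ x ∈ Y, ∑ y ∈ Y, H.eval (E 1 x y) = 0 := by
    refine Finset.sum_eq_zero fun x hx => Finset.sum_eq_zero fun y hy => ?_
    rw [hev]
    by_cases hxy : x = y
    · subst hxy; rw [C.E_diag]; simp
    · rw [hp, annih_zero hx hy hxy]; simp
  rw [hY0, mul_zero] at h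
  have hYp : (0 : ℝ) < Y.card := by exact_mod_cast hY
  have h0 : ∑ x, ∑ y, H.eval (E 1 x y) = 0 := by
    rcases mul_eq_zero.1 h.symm with h | h
    · exact absurd h (pow_ne_zero 2 hYp.ne')
    · exact h
  have hz : ∀ x y, H.eval (E 1 x y) = 0 := by
    intro x y
    have h1 := (Finset.sum_eq_zero_iff_of_nonneg
      (fun x _ => Finset.sum_nonneg fun y _ => hnn x y)).1 h0 x (Finset.mem_univ _)
    exact (Finset.sum_eq_zero_iff_of_nonneg (fun y _ => hnn x y)).1 h1 y (Finset.mem_univ _)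
  have hG := C.poly_mem p hpd
  have hG1 : (Matrix.of fun x y => p.eval (E 1 x y)) = p.eval (d 1) • (1 : Matrix X X ℝ) := by
    ext x y
    by_cases hxy : x = y
    · subst hxy
      rw [Matrix.of_apply, C.E_diag, Matrix.smul_apply, Matrix.one_apply_eq, smul_eq_mul, mul_one]
    · have h1 := hz x y
      rw [hev] at h1
      have h2 := C.lt_diag hxy
      rcases mul_eq_zero.1 h1 with h | h
      · linarith
      · simpa [hxy] using h
  rw [hG1] at hG
  have := C.mul_last hG (Fin.last n) (by rw [Fin.val_last]; omega)
  rw [mul_smul_comm, mul_one] at this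
  rcases smul_eq_zero.1 this with h | h
  · exact C.annih_ne Y h
  · exact C.E_ne _ h

end core
end AssocScheme

namespace AssocScheme
section bridge
variable {X : Type*} [Fintype X] [DecidableEq X] {n : ℕ}

lemma sum_range_cast {n k : ℕ} (hk : k ≤ n) (f : Fin (n + 1) → ℂ) :
    ∑ i ∈ Finset.range (k + 1), f ((i : ℕ) : Fin (n + 1)) =
      ∑ i ∈ Finset.univ.filter (fun i : Fin (n + 1) => (i : ℕ) ≤ k), f i := by
  refine Finset.sum_nbij' (fun i => ((i : ℕ) : Fin (n + 1))) (fun i => (i : ℕ)) ?_ ?_ ?_ ?_ ?_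
  · intro i hi
    have hi := Finset.mem_range.1 hi
    simp only [Finset.mem_filter, Finset.mem_univ, true_and]
    rw [Fin.val_cast_of_lt (by omega)]
    omega
  · intro i hi
    simp at hi ⊢
    omega
  · intro i hi
    have hi := Finset.mem_range.1 hi
    exact Fin.val_cast_of_lt (by omega)
  · intro i _
    exact Fin.cast_val_eq_self i
  · intro i _
    rfl

lemma exists_rel (S : Scheme X n) :
    ∃ r : X → X → Fin (n + 1), ∀ i x y, S.A i x y = if i = r x y then 1 else 0 := by
  classical
  have key : ∀ x y, ∃ r : Fin (n + 1), ∀ i, S.A i x y = if i = r then 1 else 0 := by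
    intro x y
    have hA : ∀ i, S.A i x y = if S.A i x y = 1 then 1 else 0 := by
      intro i
      rcases S.A_zeroOne i x y with h | h <;> simp [h]
    have h := congrFun (congrFun S.A_sum x) y
    rw [Matrix.sum_apply] at h
    have h2 : ∑ i, (if S.A i x y = 1 then (1 : ℂ) else 0) = 1 := by
      refine (Finset.sum_congr rfl fun i _ => (hA i).symm).trans ?_
      rw [h]
      rfl
    rw [Finset.sum_boole] at h2
    have h3 : (Finset.univ.filter fun i => S.A i x y = 1).card = 1 := by exact_mod_cast h2
    obtain ⟨r, hr⟩ := Finset.card_eq_one.1 h3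
    refine ⟨r, fun i => ?_⟩
    have hm : S.A i x y = 1 ↔ i = r := by
      have : i ∈ (Finset.univ.filter fun i => S.A i x y = 1) ↔ i ∈ ({r} : Finset _) := by rw [hr]
      simpa using this
    rw [hA i]
    simp only [hm]
  choose r hr using key
  exact ⟨r, fun i x y => hr x y i⟩

end bridge

/-- in a cometric scheme, `δ* ≤ 2s + 1` and the Fisher-type/degree bounds
`∑_{i ≤ ⌊(δ*-1)/2⌋} m_i ≤ |Y| ≤ ∑_{i ≤ s} m_i` hold (inequalities in the complex
order, `m_i = Q 0 i`). -/
theorem fisher_and_degree_bound {X : Type*} [Fintype X] [DecidableEq X]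
    [Nonempty X] {n : ℕ} (hn : 1 ≤ n) (S : Scheme X n) (hsym : S.IsSym)
    (q : Fin (n + 1) → Fin (n + 1) → Fin (n + 1) → ℂ) (hcom : S.Cometric q)
    (Q : Matrix (Fin (n + 1)) (Fin (n + 1)) ℂ) (hQ : S.IsQ Q)
    (Y : Finset X) (hY1 : 1 < Y.card) (hY2 : Y.card < Fintype.card X)
    (δs : Fin (n + 1))
    (hδs : IsLeast {i : Fin (n + 1) | i ≠ 0 ∧ macT Q (innerDist S Y) i ≠ 0} δs) :
    (δs : ℕ) ≤ 2 * Nat.card {i : Fin (n + 1) | i ≠ 0 ∧ innerDist S Y i ≠ 0} + 1 ∧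
      (∑ i ∈ Finset.range (((δs : ℕ) - 1) / 2 + 1), Q 0 ((i : ℕ) : Fin (n + 1))) ≤
        (Y.card : ℂ) ∧
      (Y.card : ℂ) ≤
        ∑ i ∈ Finset.range
          (Nat.card {i : Fin (n + 1) | i ≠ 0 ∧ innerDist S Y i ≠ 0} + 1),
          Q 0 ((i : ℕ) : Fin (n + 1)) := by
  classical
  obtain ⟨r, hr⟩ := exists_rel S
  obtain ⟨hkr, hq⟩ := hcom
  have hvne : (Fintype.card X : ℂ) ≠ 0 := by simp
  have hEQ : ∀ i x y, S.E i x y = (Fintype.card X : ℂ)⁻¹ * Q (r x y) i := by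
    intro i x y
    conv_lhs => rw [hQ i]
    simp [Matrix.sum_apply, hr]
  have hr0 : ∀ x y, r x y = 0 ↔ x = y := by
    intro x y
    have h := hr 0 x y
    rw [S.A_zero, Matrix.one_apply] at h
    constructor
    · intro h2
      by_contra h1
      rw [if_neg h1, if_pos h2.symm] at h
      exact zero_ne_one h
    · intro h1
      by_contra h2
      rw [if_pos h1, if_neg (Ne.symm h2)] at h
      exact one_ne_zero h
  have hrs : ∀ x y, r x y = r y x := by
    intro x y
    have h := congrFun (congrFun (hsym (r x y)) x) y
    rw [Matrix.transpose_apply, hr, hr, if_pos rfl] at h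
    by_contra hne
    rw [if_neg hne] at h
    exact zero_ne_one h
  have hEs : ∀ i x y, S.E i x y = S.E i y x := by
    intro i x y; rw [hEQ, hEQ, hrs]
  have hre : ∀ i x y, (((S.E i x y).re : ℝ) : ℂ) = S.E i x y := by
    intro i x y
    have h := (S.E_herm i).apply x y
    rw [hEs i y x] at h
    exact Complex.conj_eq_iff_re.1 h
  set E : Fin (n + 1) → Matrix X X ℝ := fun i => Matrix.of fun x y => (S.E i x y).re with hE
  have hEc : ∀ i x y, ((E i x y : ℝ) : ℂ) = S.E i x y := hre
  -- the Krein parameters are real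
  have hqre : ∀ i j k, (((q i j k).re : ℝ) : ℂ) = q i j k := by
    intro i j k
    have h1 : Matrix.hadamard (S.E i) (S.E j) * S.E k =
        ((Fintype.card X : ℂ)⁻¹ * q i j k) • S.E k := by
      rw [hkr i j, smul_mul_assoc, Finset.sum_mul]
      simp [S.E_mul, smul_smul]
    obtain ⟨x, y, hxy⟩ : ∃ x y, S.E k x y ≠ 0 := by
      by_contra hcon
      push Not at hcon
      exact S.E_ne k (by ext x y; exact hcon x y)
    have h2 := congrFun (congrFun h1 x) y
    rw [Matrix.mul_apply, Matrix.smul_apply, smul_eq_mul] at h2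
    have h3 : q i j k = (((Fintype.card X : ℝ) *
        (∑ z, E i x z * E j x z * E k z y) * (E k x y)⁻¹ : ℝ) : ℂ) := by
      push_cast
      simp only [hEc]
      simp only [Matrix.hadamard_apply] at h2
      rw [h2]
      field_simp
    rw [h3, Complex.ofReal_re]
  have C : Core_s8 E (fun i j k => (Fintype.card X : ℝ)⁻¹ * (q i j k).re)
      (fun i => ((Fintype.card X : ℂ)⁻¹ * Q 0 i).re) := by
    refine ⟨hn, inferInstance, ?_, ?_, ?_, ?_, ?_, ?_, ?_, ?_, ?_⟩
    · intro x y
      apply Complex.ofReal_injective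
      rw [hEc, S.E_zero]
      simp
    · intro i h
      apply S.E_ne i
      ext x y
      rw [← hEc, h]
      simp
    · intro i x y
      apply Complex.ofReal_injective
      rw [hEc, hEc, hEs]
    · intro i j
      ext x y
      apply Complex.ofReal_injective
      have h := congrFun (congrFun (S.E_mul i j) x) y
      rw [Matrix.mul_apply] at h ⊢
      push_cast
      simp only [hEc]
      rw [h]
      split_ifs
      · rw [hEc]
      · simp
    · ext x y
      apply Complex.ofReal_injective
      have h := congrFun (congrFun S.E_sum x) y
      rw [Matrix.sum_apply] at h ⊢
      push_cast
      simp only [hEc]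
      rw [h, Matrix.one_apply, Matrix.one_apply]
      split_ifs <;> simp
    · intro i x
      change (S.E i x x).re = _
      rw [hEQ, (hr0 x x).2 rfl]
    · intro i j x y
      apply Complex.ofReal_injective
      have h := congrFun (congrFun (hkr i j) x) y
      rw [Matrix.hadamard_apply, Matrix.smul_apply, Matrix.sum_apply, smul_eq_mul,
        Finset.mul_sum] at h
      push_cast
      simp only [hEc, hqre]
      rw [h]
      refine Finset.sum_congr rfl fun k _ => ?_
      rw [Matrix.smul_apply, smul_eq_mul]
      ring
    · intro i j k h
      simp [(hq i j k).1 h]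
    · intro i j k h
      refine mul_ne_zero (by simp) ?_
      intro h0
      apply (hq i j k).2 h
      rw [← hqre, h0]
      simp
  have hYp : 0 < Y.card := by omega
  have hYne : (Y.card : ℂ) ≠ 0 := by exact_mod_cast hYp.ne'
  have hδ : ∀ i : Fin (n + 1), i ≠ 0 → (i : ℕ) < (δs : ℕ) →
      ∑ x ∈ Y, ∑ y ∈ Y, E i x y = 0 := by
    intro i hi hlt
    have h0 : macT Q (innerDist S Y) i = 0 := by
      by_contra hne
      have := hδs.2 ⟨hi, hne⟩
      exact absurd (Fin.le_def.1 this) (by omega)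
    have h1 : macT Q (innerDist S Y) i =
        (Y.card : ℂ)⁻¹ * ((Fintype.card X : ℂ) * ∑ x ∈ Y, ∑ y ∈ Y, S.E i x y) := by
      have h2 : ∀ x y, (Fintype.card X : ℂ) * S.E i x y = ∑ j, S.A j x y * Q j i := by
        intro x y
        rw [hEQ]
        simp [hr, hvne]
      simp only [macT, innerDist, Finset.mul_sum, h2, Finset.sum_mul, mul_assoc]
      rw [Finset.sum_comm]
      refine Finset.sum_congr rfl fun x _ => ?_
      rw [Finset.sum_comm]
    rw [h1] at h0
    have h3 : ∑ x ∈ Y, ∑ y ∈ Y, S.E i x y = 0 := by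
      simpa [hYne, hvne] using h0
    apply Complex.ofReal_injective
    push_cast
    simp only [hEc]
    exact h3
  set s := Nat.card {i : Fin (n + 1) | i ≠ 0 ∧ innerDist S Y i ≠ 0} with hsdef
  set T : Finset (Fin (n + 1)) :=
    Finset.univ.filter (fun i => i ≠ 0 ∧ innerDist S Y i ≠ 0) with hT
  have hsT : s = T.card := by
    rw [hsdef, hT]
    exact Nat.subtype_card _ (by simp)
  have hsn : s ≤ n := by
    rw [hsT]
    have h : T ⊆ Finset.univ.erase 0 := by
      intro i hi
      simp [hT] at hi
      simp [hi.1]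
    have h2 := Finset.card_le_card h
    simpa using h2
  have hs : (Y.offDiag.image (fun z => E 1 z.1 z.2)).card ≤ s := by
    rw [hsT]
    refine (Finset.card_le_card ?_).trans
      (Finset.card_image_le (s := T) (f := fun j => ((Fintype.card X : ℂ)⁻¹ * Q j 1).re))
    intro t ht
    obtain ⟨⟨x, y⟩, hz, rfl⟩ := Finset.mem_image.1 ht
    obtain ⟨hx, hy, hxy⟩ := Finset.mem_offDiag.1 hz
    refine Finset.mem_image.2 ⟨r x y, ?_, ?_⟩
    · simp only [hT, Finset.mem_filter, Finset.mem_univ, true_and]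
      refine ⟨fun h => hxy ((hr0 x y).1 h), ?_⟩
      refine mul_ne_zero (inv_ne_zero hYne) ?_
      have h1 : ∑ a ∈ Y, ∑ b ∈ Y, S.A (r x y) a b =
          ((∑ a ∈ Y, ∑ b ∈ Y, (if r x y = r a b then 1 else 0) : ℕ) : ℂ) := by
        push_cast
        simp only [hr]
      rw [h1, Nat.cast_ne_zero]
      intro h0
      rw [Finset.sum_eq_zero_iff] at h0
      have h2 := h0 x hx
      rw [Finset.sum_eq_zero_iff] at h2
      simpa using h2 y hy
    · change _ = (S.E 1 x y).re
      rw [hEQ]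
  have hdd : ∀ k, k ≤ n → ∑ i ∈ Finset.range (k + 1), Q 0 ((i : ℕ) : Fin (n + 1)) =
      (((Fintype.card X : ℝ) * dd (fun i => ((Fintype.card X : ℂ)⁻¹ * Q 0 i).re) k : ℝ) : ℂ) := by
    intro k hk
    rw [sum_range_cast hk, dd]
    push_cast
    rw [Finset.mul_sum]
    refine Finset.sum_congr rfl fun i _ => ?_
    have h := hre i (Classical.arbitrary X) (Classical.arbitrary X)
    rw [hEQ, (hr0 _ _).2 rfl] at h
    rw [h]
    field_simp
  have hδpos : 0 < (δs : ℕ) := by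
    have := hδs.1.1
    exact Nat.pos_of_ne_zero fun h => this (Fin.ext h)
  have hδn : (δs : ℕ) ≤ n := by have := δs.isLt; omega
  refine ⟨C.dual hYp hs hδ hδn, ?_, ?_⟩
  · rw [hdd _ (by omega), ← Complex.ofReal_natCast]
    exact Complex.real_le_real.2 (C.fisher hYp hδ (by omega))
  · rw [hdd _ hsn, ← Complex.ofReal_natCast]
    exact Complex.real_le_real.2 (C.degree hs)

end AssocScheme
end
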